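/- arXiv:1810.12420 — 3 statements merged into one kernel-verified Lean document; each statement's English description precedes it below -/
import Mathlib

section
/- Let 1 < α < 2, let β satisfy α-1 ≤ β ≤ 1, and let r := sin(πβ)/(sin(π(α-β)) + sin(πβ)). Define k(x) := (1-x)^{α-β-1} x^{β-1}. Then the function x ↦ r·(₀I_x^{2-α} k)(x) + (1-r)·(ₓI₁^{2-α} k)(x) has derivative zero at every x ∈ (0,1); that is, 𝒩_r^α k(x) = 0 for all x ∈ (0,1), so k lies in the kernel of 𝒩_r^α. -/
open Real MeasureTheory

/-- Left Riemann–Liouville fractional integral `₀I_x^σ w`. -/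
noncomputable def leftFracInt (σ : ℝ) (w : ℝ → ℝ) (x : ℝ) : ℝ :=
  (1 / Real.Gamma σ) * ∫ s in (0:ℝ)..x, w s * (x - s) ^ (σ - 1)

/-- Right Riemann–Liouville fractional integral `ₓI₁^σ w`. -/
noncomputable def rightFracInt (σ : ℝ) (w : ℝ → ℝ) (x : ℝ) : ℝ :=
  (1 / Real.Gamma σ) * ∫ s in x..(1:ℝ), w s * (s - x) ^ (σ - 1)

/-- The function whose derivative is `𝒩_r^α w`, namely
`x ↦ r·(₀I_x^{2-α} w)(x) + (1-r)·(ₓI₁^{2-α} w)(x)`. -/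
noncomputable def fracComb (r α : ℝ) (w : ℝ → ℝ) (x : ℝ) : ℝ :=
  r * leftFracInt (2 - α) w x + (1 - r) * rightFracInt (2 - α) w x

open Set Filter Topology ProbabilityTheory

/-- The real beta integrand is integrable on the unit interval. -/
lemma integrableOn_rpow_mul_one_sub_rpow {u v : ℝ} (hu : 0 < u) (hv : 0 < v) :
    IntegrableOn (fun t : ℝ => t ^ (u - 1) * (1 - t) ^ (v - 1)) (Ioo 0 1) := by
  have h := (Complex.betaIntegral_convergent (u := u) (v := v) (by simpa) (by simpa))
  rw [intervalIntegrable_iff_integrableOn_Ioc_of_le zero_le_one] at h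
  refine (integrableOn_congr_fun (fun t ht => ?_) measurableSet_Ioo).1
    (h.mono_set Ioo_subset_Ioc_self).re
  have h1 : (0:ℝ) ≤ 1 - t := by linarith [ht.2]
  have : ((t : ℂ) ^ ((u : ℂ) - 1) * (1 - (t : ℂ)) ^ ((v : ℂ) - 1))
      = ((t ^ (u - 1) * (1 - t) ^ (v - 1) : ℝ) : ℂ) := by
    rw [Complex.ofReal_mul, Complex.ofReal_cpow ht.1.le, Complex.ofReal_cpow h1]
    push_cast
    rfl
  simp only [this, RCLike.re_to_complex, Complex.ofReal_re]

/-- The real beta integral in terms of Gamma functions. -/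
lemma integral_rpow_mul_one_sub_rpow {u v : ℝ} (hu : 0 < u) (hv : 0 < v) :
    ∫ t in Ioo (0:ℝ) 1, t ^ (u - 1) * (1 - t) ^ (v - 1) = beta u v := by
  have key : ((∫ t in Ioo (0:ℝ) 1, t ^ (u - 1) * (1 - t) ^ (v - 1) : ℝ) : ℂ)
      = Complex.betaIntegral u v := by
    rw [Complex.betaIntegral, intervalIntegral.integral_of_le zero_le_one,
      integral_Ioc_eq_integral_Ioo, ← integral_complex_ofReal]
    refine setIntegral_congr_fun measurableSet_Ioo fun t ht => ?_
    have h1 : (0:ℝ) ≤ 1 - t := by linarith [ht.2]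
    simp only [Complex.ofReal_mul, Complex.ofReal_cpow ht.1.le, Complex.ofReal_cpow h1]
    push_cast
    rfl
  rw [beta_eq_betaIntegralReal u v hu hv, ← key, Complex.ofReal_re]

/-- Euler's integral `∫ t^(q-1) (1-t)^(b-1) (1-xt)^(-(q+b))` in closed form. -/
lemma integral_rpow_mul_one_sub_mul_rpow {q b x : ℝ} (hq : 0 < q) (hb : 0 < b) (hx : x < 1) :
    ∫ t in Ioo (0:ℝ) 1, t ^ (q - 1) * (1 - t) ^ (b - 1) * (1 - x * t) ^ (-(q + b))
      = (1 - x) ^ (-q) * beta q b := by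
  have hx' : 0 < 1 - x := by linarith
  have hpos : ∀ t ∈ Ioo (0:ℝ) 1, 0 < 1 - x * t := by
    intro t ht
    nlinarith [ht.1, ht.2, mul_pos ht.1 hx']
  set f : ℝ → ℝ := fun t => t * (1 - x) / (1 - x * t) with hf
  have hder : ∀ t ∈ Ioo (0:ℝ) 1,
      HasDerivWithinAt f ((1 - x) / (1 - x * t) ^ 2) (Ioo 0 1) t := by
    intro t ht
    have h := hpos t ht
    have h1 : HasDerivAt f ((1 * (1 - x) * (1 - x * t) - t * (1 - x) * (-(x * 1)))
        / (1 - x * t) ^ 2) t :=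
      ((hasDerivAt_id t).mul_const (1 - x)).div
        (((hasDerivAt_id t).const_mul x).const_sub 1) h.ne'
    rw [show (1 - x) / (1 - x * t) ^ 2 = (1 * (1 - x) * (1 - x * t) - t * (1 - x) * (-(x * 1)))
      / (1 - x * t) ^ 2 by ring]
    exact h1.hasDerivWithinAt
  have hinj : InjOn f (Ioo 0 1) := by
    intro s hs t ht hst
    have h1 := hpos s hs
    have h2 := hpos t ht
    simp only [hf] at hst
    rw [div_eq_div_iff h1.ne' h2.ne'] at hst
    have : (s - t) * (1 - x) = 0 := by linear_combination hst
    rcases mul_eq_zero.1 this with h | h <;> linarith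
  have himg : f '' Ioo 0 1 = Ioo 0 1 := by
    ext v
    constructor
    · rintro ⟨t, ht, rfl⟩
      have h1 := hpos t ht
      refine ⟨div_pos (mul_pos ht.1 hx') h1, ?_⟩
      rw [div_lt_one h1]
      linarith [ht.2]
    · intro hv
      have h1 : 0 < 1 - x + x * v := by nlinarith [hv.1, hv.2, mul_pos hx' (sub_pos.2 hv.2)]
      refine ⟨v / (1 - x + x * v), ⟨div_pos hv.1 h1, ?_⟩, ?_⟩
      · rw [div_lt_one h1]
        nlinarith [mul_pos hx' (sub_pos.2 hv.2)]
      · have h2 : 1 - x * (v / (1 - x + x * v)) = (1 - x) / (1 - x + x * v) := by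
          field_simp
          ring
        simp only [hf, h2]
        rw [div_div_eq_mul_div, div_mul_eq_mul_div, div_mul_cancel₀ _ h1.ne',
          mul_div_cancel_right₀ _ hx'.ne']
  have hcv := integral_image_eq_integral_abs_deriv_smul measurableSet_Ioo hder hinj
    (fun v => v ^ (q - 1) * (1 - v) ^ (b - 1))
  rw [himg, integral_rpow_mul_one_sub_rpow hq hb] at hcv
  rw [hcv, ← integral_const_mul]
  refine setIntegral_congr_fun measurableSet_Ioo fun t ht => ?_
  have h1 := hpos t ht
  have h2 : 0 < 1 - t := by linarith [ht.2]
  have h3 : 1 - f t = (1 - t) / (1 - x * t) := by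
    simp only [hf]
    rw [eq_div_iff h1.ne', sub_mul, div_mul_cancel₀ _ h1.ne']
    ring
  simp only [smul_eq_mul, h3]
  rw [abs_of_pos (by positivity)]
  simp only [hf]
  rw [div_rpow (mul_pos ht.1 hx').le h1.le, mul_rpow ht.1.le hx'.le, div_rpow h2.le h1.le,
    rpow_sub_one hx'.ne', rpow_neg hx'.le, rpow_neg h1.le, rpow_add h1,
    rpow_sub_one h1.ne' q, rpow_sub_one h1.ne' b]
  generalize 1 - x * t = w at h1 ⊢
  have := (rpow_pos_of_pos hx' q).ne'
  have := (rpow_pos_of_pos h1 q).ne'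
  have := (rpow_pos_of_pos h1 b).ne'
  field_simp

lemma one_sub_mul_rpow_le {e y ρ t : ℝ} (he : e ≤ 0) (hy : y ∈ Ioo 0 ρ) (hρ : ρ < 1)
    (ht : t ∈ Ioo (0:ℝ) 1) : (1 - y * t) ^ e ≤ (1 - ρ) ^ e := by
  apply rpow_le_rpow_of_nonpos (by linarith) _ he
  nlinarith [hy.1, hy.2, ht.1, ht.2, mul_pos hy.1 (sub_pos.2 ht.2)]

/-- Differentiation of Euler's integral representation with respect to its argument. -/
lemma hasDerivAt_integral_rpow_mul_one_sub_mul_rpow {p q b x : ℝ} (hp : p ≤ 1) (hq : 0 < q)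
    (hb : 0 < b) (hx : x ∈ Ioo (0:ℝ) 1) :
    IntegrableOn (fun t : ℝ => t ^ (q - 1) * (1 - t) ^ (b - 1) * (1 - x * t) ^ (p - 1)) (Ioo 0 1) ∧
    IntegrableOn (fun t : ℝ => t ^ (q - 1) * (1 - t) ^ (b - 1) *
      ((1 - p) * t * (1 - x * t) ^ (p - 2))) (Ioo 0 1) ∧
    HasDerivAt (fun y => ∫ t in Ioo (0:ℝ) 1,
        t ^ (q - 1) * (1 - t) ^ (b - 1) * (1 - y * t) ^ (p - 1))
      (∫ t in Ioo (0:ℝ) 1, t ^ (q - 1) * (1 - t) ^ (b - 1) *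
        ((1 - p) * t * (1 - x * t) ^ (p - 2))) x := by
  obtain ⟨ρ, hxρ, hρ⟩ := exists_between hx.2
  have hint := integrableOn_rpow_mul_one_sub_rpow hq hb
  have hpos : ∀ y ∈ Ioo 0 ρ, ∀ t ∈ Ioo (0:ℝ) 1, 0 < 1 - y * t := by
    intro y hy t ht
    nlinarith [hy.1, hy.2, ht.1, ht.2, mul_pos hy.1 (sub_pos.2 ht.2)]
  have hF : IntegrableOn
      (fun t : ℝ => t ^ (q - 1) * (1 - t) ^ (b - 1) * (1 - x * t) ^ (p - 1)) (Ioo 0 1) := by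
    refine hint.mul_bdd (c := (1 - ρ) ^ (p - 1))
      (Measurable.aestronglyMeasurable (by fun_prop)) ?_
    refine (ae_restrict_iff' measurableSet_Ioo).2 (.of_forall fun t ht => ?_)
    rw [norm_of_nonneg (rpow_pos_of_pos (hpos x ⟨hx.1, hxρ⟩ t ht) _).le]
    exact one_sub_mul_rpow_le (by linarith) ⟨hx.1, hxρ⟩ hρ ht
  refine ⟨hF, hasDerivAt_integral_of_dominated_loc_of_deriv_le
    (s := Ioo 0 ρ) (Ioo_mem_nhds hx.1 hxρ)
    (F := fun y t => t ^ (q - 1) * (1 - t) ^ (b - 1) * (1 - y * t) ^ (p - 1))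
    (F' := fun y t => t ^ (q - 1) * (1 - t) ^ (b - 1) * ((1 - p) * t * (1 - y * t) ^ (p - 2)))
    (bound := fun t => t ^ (q - 1) * (1 - t) ^ (b - 1) * ((1 - p) * 1 * (1 - ρ) ^ (p - 2)))
    (.of_forall fun y => Measurable.aestronglyMeasurable (by fun_prop)) hF
    (Measurable.aestronglyMeasurable (by fun_prop)) ?_ (hint.mul_const _) ?_⟩
  · refine (ae_restrict_iff' measurableSet_Ioo).2 (.of_forall fun t ht y hy => ?_)
    have h1 := hpos y hy t ht
    have h2 : 0 < 1 - t := by linarith [ht.2]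
    have h3 := ht.1
    have h4 : 0 ≤ 1 - p := by linarith
    have h5 : 0 < 1 - ρ := by linarith
    rw [norm_of_nonneg (by positivity)]
    have := one_sub_mul_rpow_le (e := p - 2) (by linarith) hy hρ ht
    have := ht.2.le
    gcongr
  · refine (ae_restrict_iff' measurableSet_Ioo).2 (.of_forall fun t ht y hy => ?_)
    have h1 := hpos y hy t ht
    have h2 : HasDerivAt (fun y : ℝ => 1 - y * t) (-(1 * t)) y :=
      ((hasDerivAt_id y).mul_const t).const_sub 1
    refine ((h2.rpow_const (p := p - 1) (Or.inl h1.ne')).const_mul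
      (t ^ (q - 1) * (1 - t) ^ (b - 1))).congr_deriv ?_
    rw [show p - 1 - 1 = p - 2 by ring]
    ring

/-- Scaling of the fractional integral of the kernel function to the unit interval. -/
lemma integral_kernel_eq {p q b y : ℝ} (hpqb : p + q + b = 2) (hy : 0 < y) :
    ∫ s in (0:ℝ)..y, (1 - s) ^ (p - 1) * s ^ (q - 1) * (y - s) ^ (b - 1)
      = y ^ (1 - p) * ∫ t in Ioo (0:ℝ) 1,
          t ^ (q - 1) * (1 - t) ^ (b - 1) * (1 - y * t) ^ (p - 1) := by
  have h := intervalIntegral.smul_integral_comp_mul_left (a := 0) (b := 1)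
    (fun s : ℝ => (1 - s) ^ (p - 1) * s ^ (q - 1) * (y - s) ^ (b - 1)) y
  rw [mul_zero, mul_one] at h
  rw [← h, intervalIntegral.integral_of_le zero_le_one, integral_Ioc_eq_integral_Ioo,
    smul_eq_mul, ← integral_const_mul, ← integral_const_mul]
  refine setIntegral_congr_fun measurableSet_Ioo fun t ht => ?_
  have h2 : 0 ≤ 1 - t := by linarith [ht.2]
  have e : y ^ (1 - p) = y * (y ^ (q - 1) * y ^ (b - 1)) := by
    rw [show 1 - p = 1 + ((q - 1) + (b - 1)) by linarith, rpow_add hy, rpow_add hy, rpow_one]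
  rw [show y - y * t = y * (1 - t) by ring, mul_rpow hy.le ht.1.le, mul_rpow hy.le h2, e]
  ring

/-- Derivative of the left fractional integral of the kernel function. -/
lemma hasDerivAt_integral_kernel {p q b x : ℝ} (hpqb : p + q + b = 2) (hp : p ≤ 1)
    (hq : 0 < q) (hb : 0 < b) (hx : x ∈ Ioo (0:ℝ) 1) :
    HasDerivAt (fun y => ∫ s in (0:ℝ)..y, (1 - s) ^ (p - 1) * s ^ (q - 1) * (y - s) ^ (b - 1))
      ((1 - p) * beta q b * (x ^ (-p) * (1 - x) ^ (-q))) x := by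
  obtain ⟨hi1, hi2, hd⟩ := hasDerivAt_integral_rpow_mul_one_sub_mul_rpow hp hq hb hx
  have hpow : HasDerivAt (fun y : ℝ => y ^ (1 - p)) ((1 - p) * x ^ (1 - p - 1)) x :=
    hasDerivAt_rpow_const (Or.inl hx.1.ne')
  have hev : (fun y => ∫ s in (0:ℝ)..y, (1 - s) ^ (p - 1) * s ^ (q - 1) * (y - s) ^ (b - 1))
      =ᶠ[𝓝 x] fun y => y ^ (1 - p) * ∫ t in Ioo (0:ℝ) 1,
          t ^ (q - 1) * (1 - t) ^ (b - 1) * (1 - y * t) ^ (p - 1) := by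
    filter_upwards [lt_mem_nhds hx.1] with y hy using integral_kernel_eq hpqb hy
  refine HasDerivAt.congr_of_eventuallyEq ?_ hev
  refine (hpow.mul hd).congr_deriv (Eq.symm ?_)
  rw [mul_assoc (1 - p), mul_left_comm (beta q b), mul_comm (beta q b),
    ← integral_rpow_mul_one_sub_mul_rpow hq hb hx.2, ← integral_const_mul, ← integral_const_mul,
    ← integral_const_mul, ← integral_const_mul, ← integral_add (hi1.const_mul _) (hi2.const_mul _)]
  refine setIntegral_congr_fun measurableSet_Ioo fun t ht => ?_
  have h1 : 0 < 1 - x * t := by nlinarith [hx.1, hx.2, ht.1, ht.2, mul_pos hx.1 (sub_pos.2 ht.2)]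
  have e1 : (1 - x * t) ^ (p - 1) = (1 - x * t) * (1 - x * t) ^ (p - 2) := by
    rw [show p - 1 = 1 + (p - 2) by ring, rpow_add h1, rpow_one]
  have e2 : x ^ (1 - p) = x * x ^ (-p) := by
    rw [sub_eq_add_neg, rpow_add hx.1, rpow_one]
  rw [show -(q + b) = p - 2 by linarith, show 1 - p - 1 = -p by ring, e1, e2]
  ring

/-- Balance of the two one-sided constants, a consequence of Euler's reflection formula. -/
lemma sin_mul_one_sub_mul_beta {p q b : ℝ} (hpqb : p + q + b = 2) (hp : p ∈ Ioc (0:ℝ) 1)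
    (hq : q ∈ Ioc (0:ℝ) 1) :
    sin (π * q) * ((1 - p) * beta q b) = sin (π * p) * ((1 - q) * beta p b) := by
  have refl : ∀ s ∈ Ioo (0:ℝ) 1, sin (π * s) * (Gamma s * Gamma (1 - s)) = π := by
    intro s hs
    have : 0 < sin (π * s) :=
      sin_pos_of_pos_of_lt_pi (mul_pos pi_pos hs.1) (by nlinarith [hs.2, pi_pos])
    rw [Real.Gamma_mul_Gamma_one_sub, mul_div_cancel₀ _ this.ne']
  rcases hp.2.eq_or_lt with rfl | hp1
  · simp
  rcases hq.2.eq_or_lt with rfl | hq1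
  · simp
  have hp' : 0 < 1 - p := by linarith
  have hq' : 0 < 1 - q := by linarith
  have e1 : Gamma (q + b) = (1 - p) * Gamma (1 - p) := by
    rw [← Gamma_add_one hp'.ne']
    congr 1
    linarith
  have e2 : Gamma (p + b) = (1 - q) * Gamma (1 - q) := by
    rw [← Gamma_add_one hq'.ne']
    congr 1
    linarith
  have g1 := (Gamma_pos_of_pos hp').ne'
  have g2 := (Gamma_pos_of_pos hq').ne'
  rw [beta, beta, e1, e2]
  field_simp
  linear_combination Gamma b * (refl q ⟨hq.1, hq1⟩ - refl p ⟨hp.1, hp1⟩)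

/-- The kernel function `k(x) = (1-x)^{α-β-1} x^{β-1}` satisfies `𝒩_r^α k = 0` on `(0,1)`:
the defining function of `𝒩_r^α k` has derivative zero at every `x ∈ (0,1)`. -/
theorem kernel_of_N (α β : ℝ) (hα1 : 1 < α) (hα2 : α < 2)
    (hβ1 : α - 1 ≤ β) (hβ2 : β ≤ 1)
    (r : ℝ) (hr : r = Real.sin (π * β) / (Real.sin (π * (α - β)) + Real.sin (π * β)))
    (k : ℝ → ℝ) (hk : ∀ x, k x = (1 - x) ^ (α - β - 1) * x ^ (β - 1))
    (x : ℝ) (hx : x ∈ Set.Ioo (0:ℝ) 1) :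
    HasDerivAt (fracComb r α k) 0 x := by
  have hp : α - β ∈ Ioc (0:ℝ) 1 := ⟨by linarith, by linarith⟩
  have hq : β ∈ Ioc (0:ℝ) 1 := ⟨by linarith, hβ2⟩
  have hb : 0 < 2 - α := by linarith
  have hsum : sin (π * (α - β)) + sin (π * β) ≠ 0 := by
    have nonneg : ∀ s ∈ Ioc (0:ℝ) 1, 0 ≤ sin (π * s) := fun s hs =>
      sin_nonneg_of_nonneg_of_le_pi (mul_pos pi_pos hs.1).le (by nlinarith [hs.2, pi_pos])
    have pos : ∀ s ∈ Ioo (0:ℝ) 1, 0 < sin (π * s) := fun s hs =>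
      sin_pos_of_pos_of_lt_pi (mul_pos pi_pos hs.1) (by nlinarith [hs.2, pi_pos])
    rcases hβ2.eq_or_lt with rfl | h
    · linarith [pos (α - 1) ⟨hp.1, by linarith⟩, nonneg 1 hq]
    · linarith [pos β ⟨hq.1, h⟩, nonneg (α - β) hp]
  have hbal := sin_mul_one_sub_mul_beta (b := 2 - α) (by ring) hp hq
  have hL := hasDerivAt_integral_kernel (p := α - β) (q := β) (by ring) hp.2 hq.1 hb hx
  have hR := (hasDerivAt_integral_kernel (p := β) (q := α - β) (by ring) hq.2 hp.1 hb
    (x := 1 - x) ⟨by linarith [hx.2], by linarith [hx.1]⟩).comp_const_sub 1 x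
  have hfun : fracComb r α k = fun y =>
      r * (1 / Gamma (2 - α) * ∫ s in (0:ℝ)..y,
        (1 - s) ^ (α - β - 1) * s ^ (β - 1) * (y - s) ^ (2 - α - 1)) +
      (1 - r) * (1 / Gamma (2 - α) * ∫ s in (0:ℝ)..(1 - y),
        (1 - s) ^ (β - 1) * s ^ (α - β - 1) * (1 - y - s) ^ (2 - α - 1)) := by
    funext y
    have h := intervalIntegral.integral_comp_sub_left (a := 0) (b := 1 - y)
      (fun s => k s * (s - y) ^ (2 - α - 1)) 1
    rw [sub_sub_cancel, sub_zero] at h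
    simp only [fracComb, leftFracInt, rightFracInt, ← h]
    simp only [hk]
    congr 3
    refine intervalIntegral.integral_congr fun s _ => ?_
    simp only [sub_sub_cancel, sub_right_comm 1 s y]
    ring
  rw [hfun]
  refine (((hL.const_mul (1 / Gamma (2 - α))).const_mul r).add
    ((hR.const_mul (1 / Gamma (2 - α))).const_mul (1 - r))).congr_deriv ?_
  have hr1 : 1 - r = sin (π * (α - β)) / (sin (π * (α - β)) + sin (π * β)) := by
    rw [hr]
    field_simp
    ring
  rw [hr1, hr, sub_sub_cancel]
  linear_combination (1 / Gamma (2 - α) / (sin (π * (α - β)) + sin (π * β)) *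
    (x ^ (-(α - β)) * (1 - x) ^ (-β))) * hbal
end

section
/- Let 1 < α < 2, let β satisfy α-1 < β ≤ 1, let r := sin(πβ)/(sin(π(α-β)) + sin(πβ)), and set k(x) := (1-x)^{α-β-1} x^{β-1} and λ₋₁ := -(1-r)·Γ(α)·sin(πα)/sin(π(α-β)). Then for every x ∈ (0,1), 𝒩_r^α ( x·k(x) ) = λ₋₁ and 𝒩_r^α ( (1-x)·k(x) ) = -λ₋₁ (both constant functions on (0,1)). -/
open Real MeasureTheory

section FractionalWeight

open Set Filter Topology ProbabilityTheory

theorem intervalIntegrable_rpow_mul_one_sub_rpow {a b : ℝ} (ha : 0 < a) (hb : 0 < b) :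
    IntervalIntegrable (fun u : ℝ => u ^ (a - 1) * (1 - u) ^ (b - 1)) volume 0 1 := by
  have h := Complex.betaIntegral_convergent (u := a) (v := b) (by simpa) (by simpa)
  rw [intervalIntegrable_iff, uIoc_of_le zero_le_one] at h ⊢
  refine IntegrableOn.congr_fun h.re (fun u hu => ?_) measurableSet_Ioc
  simp only [RCLike.re_to_complex]
  norm_cast
  rw [← Complex.ofReal_cpow hu.1.le, ← Complex.ofReal_cpow (by linarith [hu.2])]
  norm_cast

theorem integral_rpow_mul_one_sub_rpow_s4 {a b : ℝ} (ha : 0 < a) (hb : 0 < b) :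
    ∫ u in (0:ℝ)..1, u ^ (a - 1) * (1 - u) ^ (b - 1) = beta a b := by
  rw [beta_eq_betaIntegralReal a b ha hb, Complex.betaIntegral]
  have : ∫ u in (0:ℝ)..1, (u : ℂ) ^ ((a : ℂ) - 1) * (1 - (u : ℂ)) ^ ((b : ℂ) - 1)
      = ∫ u in (0:ℝ)..1, ((u ^ (a - 1) * (1 - u) ^ (b - 1) : ℝ) : ℂ) := by
    refine intervalIntegral.integral_congr fun u hu => ?_
    rw [uIcc_of_le zero_le_one] at hu
    norm_cast
    rw [← Complex.ofReal_cpow hu.1, ← Complex.ofReal_cpow (by linarith [hu.2])]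
    norm_cast
  rw [this, intervalIntegral.integral_ofReal, Complex.ofReal_re]

/-- Euler's integral `∫₀¹ u^(a-1) (1-u)^(b-1) (1-xu)^(-e) du`. -/
noncomputable def eulerIntegral (a b e x : ℝ) : ℝ :=
  ∫ u in (0:ℝ)..1, u ^ (a - 1) * (1 - u) ^ (b - 1) * (1 - x * u) ^ (-e)

theorem one_sub_mul_pos {x u : ℝ} (hx : x < 1) (hu : u ∈ Icc (0:ℝ) 1) : 0 < 1 - x * u := by
  nlinarith [hu.1, hu.2, mul_nonneg hu.1 (sub_nonneg.2 hx.le)]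

theorem intervalIntegrable_eulerIntegral {a b : ℝ} (ha : 0 < a) (hb : 0 < b) (e : ℝ) {x : ℝ}
    (hx : x < 1) :
    IntervalIntegrable (fun u : ℝ => u ^ (a - 1) * (1 - u) ^ (b - 1) * (1 - x * u) ^ (-e))
      volume 0 1 := by
  refine (intervalIntegrable_rpow_mul_one_sub_rpow ha hb).mul_continuousOn fun u hu => ?_
  rw [uIcc_of_le zero_le_one] at hu
  exact ContinuousAt.continuousWithinAt <|
    ContinuousAt.rpow_const (by fun_prop) (Or.inl (one_sub_mul_pos hx hu).ne')

/-- Contiguity relation in the exponent of `1 - x u`. -/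
theorem eulerIntegral_eq_sub {a b : ℝ} (ha : 0 < a) (hb : 0 < b) (e : ℝ) {x : ℝ} (hx : x < 1) :
    eulerIntegral a b e x =
      eulerIntegral a b (e + 1) x - x * eulerIntegral (a + 1) b (e + 1) x := by
  unfold eulerIntegral
  rw [← intervalIntegral.integral_const_mul, ← intervalIntegral.integral_sub
    (intervalIntegrable_eulerIntegral ha hb _ hx)
    ((intervalIntegrable_eulerIntegral (by linarith) hb _ hx).const_mul _)]
  refine intervalIntegral.integral_congr_uIoo fun u hu => ?_
  rw [uIoo_of_le zero_le_one] at hu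
  have h1 := one_sub_mul_pos hx (Ioo_subset_Icc_self hu)
  rw [show a + 1 - 1 = (a - 1) + 1 by ring, rpow_add_one hu.1.ne',
    show -e = -(e + 1) + 1 by ring, rpow_add_one h1.ne']
  ring

theorem hasDerivAt_eulerIntegral {a b : ℝ} (ha : 0 < a) (hb : 0 < b) (e : ℝ) {x : ℝ}
    (hx : x < 1) :
    HasDerivAt (eulerIntegral a b e) (e * eulerIntegral (a + 1) b (e + 1) x) x := by
  obtain ⟨y, hxy, hy⟩ := exists_between hx
  have hcont : ContinuousOn (fun p : ℝ × ℝ => e * p.2 * (1 - p.1 * p.2) ^ (-(e + 1)))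
      (Icc (x - 1) y ×ˢ Icc 0 1) := by
    rintro ⟨z, u⟩ ⟨hz, hu⟩
    refine ContinuousAt.continuousWithinAt (ContinuousAt.mul (by fun_prop) ?_)
    exact ContinuousAt.rpow_const (by fun_prop)
      (Or.inl (one_sub_mul_pos (hz.2.trans_lt hy) hu).ne')
  obtain ⟨C, hC⟩ := (isCompact_Icc.prod isCompact_Icc).exists_bound_of_continuousOn hcont
  have key := intervalIntegral.hasDerivAt_integral_of_dominated_loc_of_deriv_le
    (μ := volume) (a := 0) (b := 1)
    (F := fun z u : ℝ => u ^ (a - 1) * (1 - u) ^ (b - 1) * (1 - z * u) ^ (-e))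
    (F' := fun z u : ℝ => u ^ (a - 1) * (1 - u) ^ (b - 1) *
      (e * u * (1 - z * u) ^ (-(e + 1))))
    (bound := fun u => u ^ (a - 1) * (1 - u) ^ (b - 1) * C)
    (x₀ := x) (s := Icc (x - 1) y) (Icc_mem_nhds (by linarith) hxy)
    (Eventually.of_forall fun z => (by fun_prop : Measurable _).aestronglyMeasurable)
    (intervalIntegrable_eulerIntegral ha hb e hx)
    (by fun_prop : Measurable _).aestronglyMeasurable
    (ae_of_all _ fun u hu z hz => ?_)
    ((intervalIntegrable_rpow_mul_one_sub_rpow ha hb).mul_const C)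
    (ae_of_all _ fun u hu z hz => ?_)
  · convert! key.2 using 1
    rw [eulerIntegral, ← intervalIntegral.integral_const_mul]
    refine intervalIntegral.integral_congr_uIoo fun u hu => ?_
    rw [uIoo_of_le zero_le_one] at hu
    rw [show a + 1 - 1 = (a - 1) + 1 by ring, rpow_add_one hu.1.ne']
    ring
  · rw [uIoc_of_le zero_le_one] at hu
    have h0 : 0 ≤ u ^ (a - 1) * (1 - u) ^ (b - 1) :=
      mul_nonneg (rpow_nonneg hu.1.le _) (rpow_nonneg (by linarith [hu.2]) _)
    rw [norm_mul, norm_of_nonneg h0]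
    exact mul_le_mul_of_nonneg_left (hC (z, u) ⟨hz, hu.1.le, hu.2⟩) h0
  · rw [uIoc_of_le zero_le_one] at hu
    have h1 := one_sub_mul_pos (hz.2.trans_lt hy) (Ioc_subset_Icc_self hu)
    have h2 : HasDerivAt (fun z : ℝ => 1 - z * u) (-u) z := by
      simpa using ((hasDerivAt_id z).mul_const u).const_sub 1
    convert! (h2.rpow_const (p := -e) (Or.inl h1.ne')).const_mul
      (u ^ (a - 1) * (1 - u) ^ (b - 1)) using 1
    rw [show -e - 1 = -(e + 1) by ring]
    ring

/-- Relation obtained by integrating the derivative of `u^a (1-u)^b (1-xu)^(-e)`. -/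
theorem eulerIntegral_three_term {a b : ℝ} (ha : 0 < a) (hb : 0 < b) (e : ℝ) {x : ℝ}
    (hx : x < 1) :
    a * eulerIntegral a b (e + 1) x
      - (a + b + (a - e) * x) * eulerIntegral (a + 1) b (e + 1) x
      + (a + b - e) * x * eulerIntegral (a + 2) b (e + 1) x = 0 := by
  have i0 := (intervalIntegrable_eulerIntegral ha hb (e + 1) hx).const_mul a
  have i1 := (intervalIntegrable_eulerIntegral (by linarith : 0 < a + 1) hb (e + 1) hx).const_mul
    (a + b + (a - e) * x)
  have i2 := (intervalIntegrable_eulerIntegral (by linarith : 0 < a + 2) hb (e + 1) hx).const_mul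
    ((a + b - e) * x)
  unfold eulerIntegral
  simp only [← intervalIntegral.integral_const_mul]
  rw [← intervalIntegral.integral_sub i0 i1, ← intervalIntegral.integral_add (i0.sub i1) i2]
  rw [intervalIntegral.integral_eq_sub_of_hasDerivAt_of_le zero_le_one
    (f := fun u => u ^ a * (1 - u) ^ b * (1 - x * u) ^ (-e)) ?_ ?_ ((i0.sub i1).add i2)]
  · simp [ha.ne', hb.ne']
  · intro u hu
    refine ContinuousAt.continuousWithinAt (ContinuousAt.mul (ContinuousAt.mul ?_ ?_) ?_)
    · exact ContinuousAt.rpow_const (by fun_prop) (Or.inr ha.le)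
    · exact ContinuousAt.rpow_const (by fun_prop) (Or.inr hb.le)
    · exact ContinuousAt.rpow_const (by fun_prop) (Or.inl (one_sub_mul_pos hx hu).ne')
  · intro u hu
    have hu0 : u ≠ 0 := hu.1.ne'
    have hu1 : 1 - u ≠ 0 := by linarith [hu.2]
    have hu2 : 1 - x * u ≠ 0 := (one_sub_mul_pos hx (Ioo_subset_Icc_self hu)).ne'
    have d0 := (hasDerivAt_id u).rpow_const (p := a) (Or.inl hu0)
    have d1 := ((hasDerivAt_id u).const_sub 1).rpow_const (p := b) (Or.inl hu1)
    have d2 := (((hasDerivAt_id u).const_mul x).const_sub 1).rpow_const (p := -e) (Or.inl hu2)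
    convert! (d0.mul d1).mul d2 using 1
    simp only [id, Pi.mul_apply]
    rw [show a + 1 - 1 = a - 1 + 1 by ring, show a + 2 - 1 = a - 1 + 1 + 1 by ring,
      show u ^ a = u ^ (a - 1 + 1) by ring_nf, show (1 - u) ^ b = (1 - u) ^ (b - 1 + 1) by ring_nf,
      show (1 - x * u) ^ (-e) = (1 - x * u) ^ (-(e + 1) + 1) by ring_nf,
      show -e - 1 = -(e + 1) by ring]
    simp only [rpow_add_one hu0, rpow_add_one hu1, rpow_add_one hu2]
    ring

theorem eulerIntegral_zero {a b : ℝ} (ha : 0 < a) (hb : 0 < b) (e : ℝ) :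
    eulerIntegral a b e 0 = beta a b := by
  simp [eulerIntegral, integral_rpow_mul_one_sub_rpow_s4 ha hb]

theorem eulerIntegral_add {a b : ℝ} (ha : 0 < a) (hb : 0 < b) {x : ℝ} (hx : x < 1) :
    eulerIntegral a b (a + b) x = (1 - x) ^ (-a) * beta a b := by
  have hder : ∀ y ∈ Iio (1:ℝ),
      HasDerivAt (fun y => (1 - y) ^ a * eulerIntegral a b (a + b) y) 0 y := by
    intro y hy
    have hy1 : 1 - y ≠ 0 := by linarith [mem_Iio.1 hy]
    convert! (((hasDerivAt_id y).const_sub 1).rpow_const (p := a) (Or.inl hy1)).mul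
      (hasDerivAt_eulerIntegral ha hb (a + b) hy) using 1
    have h := eulerIntegral_three_term ha hb (a + b) hy
    rw [eulerIntegral_eq_sub ha hb (a + b) hy]
    simp only [id]
    rw [show (1 - y) ^ a = (1 - y) ^ (a - 1 + 1) by ring_nf, rpow_add_one hy1]
    linear_combination (1 - y) ^ (a - 1) * h
  have hconst := isOpen_Iio.is_const_of_deriv_eq_zero isPreconnected_Iio
    (fun y hy => (hder y hy).differentiableAt.differentiableWithinAt)
    (fun y hy => (hder y hy).deriv) (mem_Iio.2 hx) (mem_Iio.2 zero_lt_one)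
  simp only [sub_zero, one_rpow, one_mul, eulerIntegral_zero ha hb] at hconst
  rw [← hconst, ← mul_assoc, ← rpow_add (by linarith)]
  simp

theorem tendsto_eulerIntegral_one {a b e : ℝ} (ha : 0 < a) (he : 0 ≤ e) (hb : e < b) :
    Tendsto (eulerIntegral a b e) (𝓝[<] 1) (𝓝 (beta a (b - e))) := by
  have hI := intervalIntegrable_rpow_mul_one_sub_rpow ha (sub_pos.2 hb)
  rw [← integral_rpow_mul_one_sub_rpow_s4 ha (sub_pos.2 hb)]
  have hae : ∀ᵐ u : ℝ, u ∈ uIoc (0:ℝ) 1 → u ∈ Ioo (0:ℝ) 1 := by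
    filter_upwards [Measure.ae_ne volume (1:ℝ)] with u hu h
    rw [uIoc_of_le zero_le_one] at h
    exact ⟨h.1, lt_of_le_of_ne h.2 hu⟩
  have hsplit : ∀ u ∈ Ioo (0:ℝ) 1, u ^ (a - 1) * (1 - u) ^ (b - e - 1) =
      u ^ (a - 1) * (1 - u) ^ (b - 1) * (1 - u) ^ (-e) := by
    intro u hu
    rw [mul_assoc, ← rpow_add (by linarith [hu.2])]
    ring_nf
  refine intervalIntegral.tendsto_integral_filter_of_dominated_convergence _
    (Eventually.of_forall fun z => (by fun_prop : Measurable _).aestronglyMeasurable)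
    ?_ hI ?_
  · filter_upwards [self_mem_nhdsWithin] with y (hy : y < 1)
    filter_upwards [hae] with u hu h
    have hu := hu h
    have h1 : 0 < 1 - u := by linarith [hu.2]
    have h2 : 1 - u ≤ 1 - y * u := by nlinarith [hu.1]
    have h0 : 0 ≤ u ^ (a - 1) * (1 - u) ^ (b - 1) :=
      mul_nonneg (rpow_nonneg hu.1.le _) (rpow_nonneg h1.le _)
    rw [hsplit u hu, norm_of_nonneg (mul_nonneg h0 (rpow_nonneg (h1.le.trans h2) _))]
    exact mul_le_mul_of_nonneg_left (rpow_le_rpow_of_nonpos h1 h2 (by linarith)) h0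
  · filter_upwards [hae] with u hu h
    have hu := hu h
    have h1 : 1 - u ≠ 0 := by linarith [hu.2]
    rw [hsplit u hu]
    have : ContinuousAt (fun y : ℝ => u ^ (a - 1) * (1 - u) ^ (b - 1) * (1 - y * u) ^ (-e)) 1 :=
      ContinuousAt.mul (by fun_prop)
        (ContinuousAt.rpow_const (by fun_prop) (Or.inl (by simpa using h1)))
    simpa [ContinuousAt] using this.tendsto.mono_left nhdsWithin_le_nhds

theorem leftFracInt_rpow_mul_one_sub_rpow (a b e : ℝ) {x : ℝ} (hx : 0 < x) :
    leftFracInt b (fun s => s ^ (a - 1) * (1 - s) ^ (-e)) x =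
      1 / Gamma b * (x ^ (a + b - 1) * eulerIntegral a b e x) := by
  unfold leftFracInt eulerIntegral
  have h := intervalIntegral.integral_comp_mul_left (a := 0) (b := 1)
    (fun s => s ^ (a - 1) * (1 - s) ^ (-e) * (x - s) ^ (b - 1)) hx.ne'
  rw [mul_zero, mul_one, smul_eq_mul, eq_inv_mul_iff_mul_eq₀ hx.ne'] at h
  rw [← h, ← intervalIntegral.integral_const_mul,
    ← intervalIntegral.integral_const_mul (x ^ (a + b - 1))]
  congr 1
  refine intervalIntegral.integral_congr_uIoo fun u hu => ?_
  rw [uIoo_of_le zero_le_one] at hu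
  rw [show x - x * u = x * (1 - u) by ring, mul_rpow hx.le hu.1.le,
    mul_rpow hx.le (by linarith [hu.2]), show a + b - 1 = (a - 1) + (b - 1) + 1 by ring,
    rpow_add_one hx.ne', rpow_add hx]
  ring

theorem rightFracInt_eq_leftFracInt (σ : ℝ) (w : ℝ → ℝ) (x : ℝ) :
    rightFracInt σ w x = leftFracInt σ (fun s => w (1 - s)) (1 - x) := by
  have h := intervalIntegral.integral_comp_sub_left (a := 0) (b := 1 - x)
    (fun s => w s * (s - x) ^ (σ - 1)) 1
  rw [sub_sub_cancel, sub_zero] at h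
  simp only [rightFracInt, leftFracInt, ← h, sub_right_comm]

/-- The derivative of the left fractional integral of order `b` of `s^(a-1) (1-s)^(-(a+b-1))`. -/
noncomputable def leftFracDeriv (a b x : ℝ) : ℝ :=
  1 / Gamma b * ((a + b - 1) * x ^ (a + b - 2) * (1 - x) ^ (-a) * beta a b)

section LeftDerivative

variable {a b x : ℝ}

theorem hasDerivAt_leftFracInt_weight (ha : 0 < a) (hb : 0 < b) (hx : x ∈ Ioo (0:ℝ) 1) :
    HasDerivAt (leftFracInt b (fun s => s ^ (a - 1) * (1 - s) ^ (-(a + b - 1))))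
      (leftFracDeriv a b x) x := by
  have hE := eulerIntegral_eq_sub ha hb (a + b - 1) hx.2
  have hB := eulerIntegral_add ha hb hx.2
  have hd := ((hasDerivAt_id x).rpow_const (p := a + b - 1) (Or.inl hx.1.ne')).mul
      (hasDerivAt_eulerIntegral ha hb (a + b - 1) hx.2)
  have hev := (eventually_gt_nhds hx.1).mono fun y hy =>
    leftFracInt_rpow_mul_one_sub_rpow a b (a + b - 1) hy
  refine HasDerivAt.congr_of_eventuallyEq ?_ hev
  convert! hd.const_mul (1 / Gamma b) using 1
  simp only [id, sub_add_cancel] at hE ⊢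
  rw [leftFracDeriv, hE, mul_assoc _ ((1 - x) ^ (-a)), ← hB,
    show x ^ (a + b - 1) = x ^ (a + b - 2 + 1) by ring_nf, rpow_add_one hx.1.ne',
    show a + b - 1 - 1 = a + b - 2 by ring]
  ring

theorem id_mul_weight (ha : 0 < a) (e : ℝ) :
    (fun s : ℝ => s * (s ^ (a - 1) * (1 - s) ^ (-e))) =
      fun s => s ^ (a + 1 - 1) * (1 - s) ^ (-e) := by
  funext s
  rcases eq_or_ne s 0 with rfl | hs
  · simp [ha.ne']
  · rw [show a + 1 - 1 = a - 1 + 1 by ring, rpow_add_one hs]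
    ring

theorem hasDerivAt_leftFracInt_id_mul_weight (ha : 0 < a) (hb : 0 < b) (hx : x ∈ Ioo (0:ℝ) 1) :
    HasDerivAt (leftFracInt b (fun s => s * (s ^ (a - 1) * (1 - s) ^ (-(a + b - 1)))))
      ((1 - b) * leftFracInt b (fun s => s ^ (a - 1) * (1 - s) ^ (-(a + b - 1))) x
        + x * leftFracDeriv a b x) x := by
  have ha1 : 0 < a + 1 := by linarith
  have hE0 := eulerIntegral_eq_sub ha hb (a + b - 1) hx.2
  have hE1 := eulerIntegral_eq_sub ha1 hb (a + b - 1) hx.2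
  have hT := eulerIntegral_three_term ha hb (a + b - 1) hx.2
  have hB := eulerIntegral_add ha hb hx.2
  have hd := ((hasDerivAt_id x).rpow_const (p := a + 1 + b - 1) (Or.inl hx.1.ne')).mul
      (hasDerivAt_eulerIntegral ha1 hb (a + b - 1) hx.2)
  have hev := (eventually_gt_nhds hx.1).mono fun y hy =>
    leftFracInt_rpow_mul_one_sub_rpow (a + 1) b (a + b - 1) hy
  rw [id_mul_weight ha, leftFracInt_rpow_mul_one_sub_rpow a b _ hx.1]
  refine HasDerivAt.congr_of_eventuallyEq ?_ hev
  convert! hd.const_mul (1 / Gamma b) using 1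
  simp only [id, sub_add_cancel, show a + 1 + 1 = a + 2 by ring] at hE0 hE1 hT ⊢
  rw [leftFracDeriv, hE0, hE1, mul_assoc _ ((1 - x) ^ (-a)), ← hB,
    show a + 1 + b - 1 - 1 = a + b - 2 + 1 by ring,
    show x ^ (a + b - 1) = x ^ (a + b - 2 + 1) by ring_nf,
    show a + 1 + b - 1 = a + b - 2 + 1 + 1 by ring]
  simp only [rpow_add_one hx.1.ne']
  linear_combination (1 / Gamma b * x ^ (a + b - 2) * x) * hT

theorem hasDerivAt_leftFracInt_one_sub_mul_weight (ha : 0 < a) (hb : 0 < b) (hab : a + b ≠ 2)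
    (hx : x ∈ Ioo (0:ℝ) 1) :
    HasDerivAt (leftFracInt b (fun s => (1 - s) * (s ^ (a - 1) * (1 - s) ^ (-(a + b - 1)))))
      ((1 - x) * leftFracDeriv a b x
        - (1 - b) * leftFracInt b (fun s => s ^ (a - 1) * (1 - s) ^ (-(a + b - 1))) x) x := by
  have hfun : (fun s : ℝ => (1 - s) * (s ^ (a - 1) * (1 - s) ^ (-(a + b - 1)))) =
      fun s => s ^ (a - 1) * (1 - s) ^ (-(a + b - 2)) := by
    funext s
    rcases eq_or_ne (1 - s) 0 with hs | hs
    · have : -(a + b - 2) ≠ 0 := fun h => hab (by linarith)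
      rw [hs, zero_rpow this, zero_mul, mul_zero]
    · rw [show -(a + b - 2) = -(a + b - 1) + 1 by ring, rpow_add_one hs]
      ring
  have hsub : leftFracInt b (fun s => (1 - s) * (s ^ (a - 1) * (1 - s) ^ (-(a + b - 1)))) =ᶠ[𝓝 x]
      fun y => leftFracInt b (fun s => s ^ (a - 1) * (1 - s) ^ (-(a + b - 1))) y -
        leftFracInt b (fun s => s * (s ^ (a - 1) * (1 - s) ^ (-(a + b - 1)))) y := by
    filter_upwards [Ioo_mem_nhds hx.1 hx.2] with y hy
    have hE := eulerIntegral_eq_sub ha hb (a + b - 2) hy.2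
    rw [show a + b - 2 + 1 = a + b - 1 by ring] at hE
    rw [hfun, id_mul_weight ha, leftFracInt_rpow_mul_one_sub_rpow _ _ _ hy.1,
      leftFracInt_rpow_mul_one_sub_rpow _ _ _ hy.1, leftFracInt_rpow_mul_one_sub_rpow _ _ _ hy.1,
      hE, show a + 1 + b - 1 = a + b - 1 + 1 by ring, rpow_add_one hy.1.ne']
    ring
  refine HasDerivAt.congr_of_eventuallyEq ?_ hsub
  convert! (hasDerivAt_leftFracInt_weight ha hb hx).sub
    (hasDerivAt_leftFracInt_id_mul_weight ha hb hx) using 1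
  ring

end LeftDerivative

theorem one_sub_div_Gamma {a : ℝ} (ha : 0 < a) :
    (1 - a) / Gamma (2 - a) = sin (π * a) * Gamma a / π := by
  rcases eq_or_ne a 1 with rfl | h1
  · simp
  have h1' : 1 - a ≠ 0 := sub_ne_zero.2 h1.symm
  have hG : Gamma (1 - a) = π / sin (π * a) / Gamma a := by
    rw [← Gamma_mul_Gamma_one_sub, mul_div_cancel_left₀ _ (Gamma_pos_of_pos ha).ne']
  rw [show 2 - a = 1 - a + 1 by ring, Gamma_add_one h1', div_mul_cancel_left₀ h1', hG, inv_div,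
    div_div_eq_mul_div, mul_comm]

theorem weight_comp_one_sub (α β : ℝ) :
    (fun s : ℝ => (1 - s) ^ (β - 1) * (1 - (1 - s)) ^ (-(β + (2 - α) - 1))) =
      fun s => s ^ (α - β - 1) * (1 - s) ^ (-(α - β + (2 - α) - 1)) := by
  funext s
  rw [mul_comm, sub_sub_cancel]
  ring_nf

/-- The derivatives of the left and right fractional integrals of the weight cancel. -/
theorem leftFracDeriv_cancel {α β r : ℝ} (ha : 0 < β) (ha' : 0 < α - β)
    (hr : r * sin (π * (α - β)) = (1 - r) * sin (π * β)) (x : ℝ) :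
    r * leftFracDeriv β (2 - α) x = (1 - r) * leftFracDeriv (α - β) (2 - α) (1 - x) := by
  have hbeta : ∀ a, (a + (2 - α) - 1) * beta a (2 - α) =
      Gamma a * Gamma (2 - α) * ((1 - (α - a)) / Gamma (2 - (α - a))) := by
    intro a
    rw [beta, show a + (2 - α) = 2 - (α - a) by ring]
    ring
  have e1 := hbeta β
  have e2 := hbeta (α - β)
  rw [one_sub_div_Gamma ha'] at e1
  rw [sub_sub_cancel, one_sub_div_Gamma ha] at e2
  unfold leftFracDeriv
  rw [show β + (2 - α) - 2 = -(α - β) by ring, show α - β + (2 - α) - 2 = -β by ring,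
    sub_sub_cancel]
  linear_combination (1 / Gamma (2 - α) * x ^ (-(α - β)) * (1 - x) ^ (-β)) *
    (r * e1 - (1 - r) * e2 + Gamma β * Gamma (2 - α) * Gamma (α - β) / π * hr)

section Weight

variable {α β r x : ℝ}

theorem hasDerivAt_rightFracInt {w : ℝ → ℝ} {σ d : ℝ}
    (h : HasDerivAt (leftFracInt σ (fun s => w (1 - s))) d (1 - x)) :
    HasDerivAt (rightFracInt σ w) (-d) x := by
  rw [funext (rightFracInt_eq_leftFracInt σ w)]
  simpa using h.comp_const_sub 1 x

theorem hasDerivAt_fracComb {w : ℝ → ℝ} {d e : ℝ} (hd : HasDerivAt (leftFracInt (2 - α) w) d x)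
    (he : HasDerivAt (leftFracInt (2 - α) (fun s => w (1 - s))) e (1 - x)) :
    HasDerivAt (fracComb r α w) (r * d - (1 - r) * e) x := by
  convert! (hd.const_mul r).add ((hasDerivAt_rightFracInt he).const_mul (1 - r)) using 1
  ring

theorem fracComb_weight_eq (hα2 : α < 2) (hα1 : 1 < α) (hβ1 : α - 1 < β) (hβ2 : β ≤ 1)
    (hr : r * sin (π * (α - β)) = (1 - r) * sin (π * β)) (hx : x ∈ Ioo (0:ℝ) 1) :
    fracComb r α (fun s => s ^ (β - 1) * (1 - s) ^ (-(β + (2 - α) - 1))) x =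
      (1 - r) / Gamma (2 - α) * (π / sin (π * (α - β))) := by
  set F := fracComb r α (fun s => s ^ (β - 1) * (1 - s) ^ (-(β + (2 - α) - 1))) with hF
  have hb : 0 < 2 - α := by linarith
  have ha : 0 < β := by linarith
  have ha' : 0 < α - β := by linarith
  have hder : ∀ y ∈ Ioo (0:ℝ) 1, HasDerivAt F 0 y := by
    intro y hy
    have hy' : 1 - y ∈ Ioo (0:ℝ) 1 := ⟨by linarith [hy.2], by linarith [hy.1]⟩
    have h := hasDerivAt_fracComb (r := r) (hasDerivAt_leftFracInt_weight ha hb hy)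
      (by rw [weight_comp_one_sub]; exact hasDerivAt_leftFracInt_weight ha' hb hy')
    rwa [leftFracDeriv_cancel ha ha' hr, sub_self] at h
  have hconst : ∀ y ∈ Ioo (0:ℝ) 1, F y = F x := fun y hy =>
    isOpen_Ioo.is_const_of_deriv_eq_zero isPreconnected_Ioo
      (fun y hy => (hder y hy).differentiableAt.differentiableWithinAt)
      (fun y hy => (hder y hy).deriv) hy hx
  have hnhds : Ioo (0:ℝ) 1 ∈ 𝓝[>] 0 := Ioo_mem_nhdsGT zero_lt_one
  have hev : (fun y => r * (1 / Gamma (2 - α) * (y ^ (β + (2 - α) - 1) *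
        eulerIntegral β (2 - α) (β + (2 - α) - 1) y)) +
      (1 - r) * (1 / Gamma (2 - α) * ((1 - y) ^ (α - β + (2 - α) - 1) *
        eulerIntegral (α - β) (2 - α) (α - β + (2 - α) - 1) (1 - y)))) =ᶠ[𝓝[>] 0] fun _ => F x := by
    filter_upwards [hnhds] with y hy
    rw [← hconst y hy, hF, fracComb, rightFracInt_eq_leftFracInt, weight_comp_one_sub,
      leftFracInt_rpow_mul_one_sub_rpow _ _ _ hy.1,
      leftFracInt_rpow_mul_one_sub_rpow _ _ _ (by linarith [hy.2])]
  have hleft : Tendsto (fun y : ℝ => y ^ (β + (2 - α) - 1) *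
      eulerIntegral β (2 - α) (β + (2 - α) - 1) y) (𝓝[>] 0) (𝓝 0) := by
    have h1 : ContinuousAt (fun y : ℝ => y ^ (β + (2 - α) - 1)) 0 :=
      continuousAt_id.rpow_const (Or.inr (by linarith))
    have h2 := (hasDerivAt_eulerIntegral ha hb (β + (2 - α) - 1) zero_lt_one).continuousAt
    have h := (h1.mul h2).tendsto.mono_left (nhdsWithin_le_nhds (s := Ioi 0))
    rw [Pi.mul_apply, zero_rpow (by linarith : β + (2 - α) - 1 ≠ 0), zero_mul] at h
    exact h
  have hright : Tendsto (fun y : ℝ => (1 - y) ^ (α - β + (2 - α) - 1) *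
      eulerIntegral (α - β) (2 - α) (α - β + (2 - α) - 1) (1 - y)) (𝓝[>] 0)
      (𝓝 (π / sin (π * (α - β)))) := by
    have h1 : ContinuousAt (fun y : ℝ => (1 - y) ^ (α - β + (2 - α) - 1)) 0 :=
      ContinuousAt.rpow_const (by fun_prop) (Or.inl (by simp))
    have h2 := h1.tendsto.mono_left (nhdsWithin_le_nhds (s := Ioi 0))
    have h3 : Tendsto (fun y : ℝ => 1 - y) (𝓝[>] 0) (𝓝[<] 1) := by
      refine tendsto_nhdsWithin_iff.2 ⟨?_, ?_⟩
      · have : ContinuousAt (fun y : ℝ => 1 - y) 0 := by fun_prop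
        simpa using this.tendsto.mono_left (nhdsWithin_le_nhds (s := Ioi 0))
      · filter_upwards [self_mem_nhdsWithin] with y hy
        exact sub_lt_self (1:ℝ) hy
    have h4 := (tendsto_eulerIntegral_one ha' (by linarith : 0 ≤ α - β + (2 - α) - 1)
      (by linarith : _ < 2 - α)).comp h3
    have hbeta : beta (α - β) (2 - α - (α - β + (2 - α) - 1)) = π / sin (π * (α - β)) := by
      rw [← Gamma_mul_Gamma_one_sub, beta,
        show 2 - α - (α - β + (2 - α) - 1) = 1 - (α - β) by ring]
      simp
    rw [hbeta] at h4
    simpa using h2.mul h4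
  have hlim := ((hleft.const_mul (1 / Gamma (2 - α))).const_mul r).add
    ((hright.const_mul (1 / Gamma (2 - α))).const_mul (1 - r))
  rw [tendsto_nhds_unique tendsto_const_nhds (hlim.congr' hev)]
  ring

end Weight

end FractionalWeight

/-- `𝒩_r^α (x·k(x)) = λ₋₁` and `𝒩_r^α ((1-x)·k(x)) = -λ₋₁` on `(0,1)`. -/
theorem N_of_xk_and_one_sub_xk (α β : ℝ) (hα1 : 1 < α) (hα2 : α < 2)
    (hβ1 : α - 1 < β) (hβ2 : β ≤ 1)
    (r : ℝ) (hr : r = Real.sin (π * β) / (Real.sin (π * (α - β)) + Real.sin (π * β)))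
    (k : ℝ → ℝ) (hk : ∀ x, k x = (1 - x) ^ (α - β - 1) * x ^ (β - 1))
    (lamm1 : ℝ)
    (hlamm1 : lamm1 = -(1 - r) * Real.Gamma α * Real.sin (π * α) / Real.sin (π * (α - β)))
    (x : ℝ) (hx : x ∈ Set.Ioo (0:ℝ) 1) :
    HasDerivAt (fracComb r α (fun s => s * k s)) lamm1 x ∧
    HasDerivAt (fracComb r α (fun s => (1 - s) * k s)) (-lamm1) x := by
  have hb : 0 < 2 - α := by linarith
  have ha : 0 < β := by linarith
  have ha' : 0 < α - β := by linarith
  have hx' : 1 - x ∈ Set.Ioo (0:ℝ) 1 := ⟨by linarith [hx.2], by linarith [hx.1]⟩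
  have hs1 : 0 < Real.sin (π * (α - β)) :=
    Real.sin_pos_of_pos_of_lt_pi (by positivity) (by nlinarith [Real.pi_pos])
  have hs2 : 0 ≤ Real.sin (π * β) :=
    Real.sin_nonneg_of_nonneg_of_le_pi (by positivity) (by nlinarith [Real.pi_pos])
  have hbal : r * Real.sin (π * (α - β)) = (1 - r) * Real.sin (π * β) := by
    rw [hr]
    field_simp
    ring
  have hk' : k = fun s => s ^ (β - 1) * (1 - s) ^ (-(β + (2 - α) - 1)) := by
    funext s
    rw [hk, mul_comm]
    ring_nf
  have hrefl := weight_comp_one_sub α β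
  have hcancel := leftFracDeriv_cancel ha ha' hbal x
  have hC := fracComb_weight_eq hα2 hα1 hβ1 hβ2 hbal hx
  rw [fracComb, rightFracInt_eq_leftFracInt, hrefl] at hC
  have hlam : lamm1 = (α - 1) * ((1 - r) / Real.Gamma (2 - α) * (π / Real.sin (π * (α - β)))) := by
    have h := one_sub_div_Gamma (by linarith : 0 < α)
    have hpi := Real.pi_ne_zero
    rw [hlamm1, show (α - 1) * ((1 - r) / Real.Gamma (2 - α) * (π / Real.sin (π * (α - β)))) =
      -(1 - r) * π / Real.sin (π * (α - β)) * ((1 - α) / Real.Gamma (2 - α)) by ring, h]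
    field_simp
  have hrefl' := congrFun hrefl
  subst hk'
  constructor
  · convert! hasDerivAt_fracComb (r := r) (hasDerivAt_leftFracInt_id_mul_weight ha hb hx) (by
      simp only [hrefl']
      exact hasDerivAt_leftFracInt_one_sub_mul_weight ha' hb (by linarith) hx') using 1
    rw [hlam]
    linear_combination (1 - α) * hC - x * hcancel
  · convert! hasDerivAt_fracComb (r := r)
      (hasDerivAt_leftFracInt_one_sub_mul_weight ha hb (by linarith) hx) (by
        simp only [hrefl']
        simp only [sub_sub_cancel]
        exact hasDerivAt_leftFracInt_id_mul_weight ha' hb hx') using 1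
    rw [hlam]
    linear_combination (α - 1) * hC - (1 - x) * hcancel
end

section
/- Let 1 < α < 2, let β satisfy α-1 < β ≤ 1, let r := sin(πβ)/(sin(π(α-β)) + sin(πβ)), set λ_n := [sin(πα)/(sin(π(α-β)) + sin(πβ))]·Γ(n+α)/n! for n ≥ 0 and λ₋₁ := -(1-r)·Γ(α)·sin(πα)/sin(π(α-β)). Let f : (0,1) → ℝ satisfy ∫₀¹ ρ^{(β-1,α-β-1)} f² < ∞, and define f_i := ∫₀¹ ρ^{(β-1,α-β-1)}(x) f(x) G_i^{(β-1,α-β-1)}(x) dx, c_i := f_{i+1}/(λ_i·|‖G_{i+1}^{(β-1,α-β-1)}‖|²) for i ≥ 0, c₋₁ := f₀/(λ₋₁·|‖G_0^{(β-1,α-β-1)}‖|²), k(x) := (1-x)^{α-β-1}x^{β-1}, and q_N(x) := c₋₁·x·k(x) + ρ^{(α-β,β)}(x)·Σ_{i=0}^{N-1} c_i G_i^{(α-β,β)}(x). Then for every N ≥ 0 and every x ∈ (0,1), 𝒩_r^α q_N(x) = Σ_{i=0}^{N} [f_i / |‖G_i^{(β-1,α-β-1)}‖|²] · G_i^{(β-1,α-β-1)}(x).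 -/
open Real MeasureTheory

/-- Jacobi polynomial `P_n^{(a,b)}(x)`. -/
noncomputable def jacobiP (a b : ℝ) (n : ℕ) (x : ℝ) : ℝ :=
  ∑ m ∈ Finset.range (n + 1),
    (1 / 2 ^ n : ℝ) *
      (Real.Gamma ((n : ℝ) + a + 1) /
        (Real.Gamma ((m : ℝ) + 1) * Real.Gamma ((n : ℝ) + a - (m : ℝ) + 1))) *
      (Real.Gamma ((n : ℝ) + b + 1) /
        (Real.Gamma ((n : ℝ) - (m : ℝ) + 1) * Real.Gamma (b + (m : ℝ) + 1))) *
      (x - 1) ^ (n - m) * (x + 1) ^ m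

/-- Shifted Jacobi polynomial `G_n^{(a,b)}(t) = P_n^{(a,b)}(2t-1)`. -/
noncomputable def jacobiG (a b : ℝ) (n : ℕ) (t : ℝ) : ℝ :=
  jacobiP a b n (2 * t - 1)

/-- Square of the norm constant `|‖G_n^{(a,b)}‖|`. -/
noncomputable def Gnorm2 (a b : ℝ) (n : ℕ) : ℝ :=
  Real.Gamma ((n : ℝ) + a + 1) * Real.Gamma ((n : ℝ) + b + 1) /
    ((2 * (n : ℝ) + a + b + 1) * Real.Gamma ((n : ℝ) + 1) * Real.Gamma ((n : ℝ) + a + b + 1))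

/-- The weight function `ρ^{(a,b)}(x) = (1-x)^a x^b`. -/
noncomputable def rho (a b x : ℝ) : ℝ := (1 - x) ^ a * x ^ b

/-- The eigenvalue `λ_n = [sin(πα)/(sin(π(α-β))+sin(πβ))]·Γ(n+α)/n!`. -/
noncomputable def lamda (α β : ℝ) (n : ℕ) : ℝ :=
  Real.sin (π * α) / (Real.sin (π * (α - β)) + Real.sin (π * β)) *
    (Real.Gamma ((n : ℝ) + α) / (n.factorial : ℝ))

open Polynomial

/-- The Taylor coefficient `(c)_n / n!` of `(1 - z) ^ (-c)`. -/
noncomputable def binomSeriesCoeff (c : ℝ) (n : ℕ) : ℝ :=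
  (ascPochhammer ℝ n).eval c / (n.factorial : ℝ)

lemma binomSeriesCoeff_zero (c : ℝ) : binomSeriesCoeff c 0 = 1 := by
  simp [binomSeriesCoeff]

lemma succ_mul_binomSeriesCoeff_succ (c : ℝ) (n : ℕ) :
    ((n : ℝ) + 1) * binomSeriesCoeff c (n + 1) = (c + n) * binomSeriesCoeff c n := by
  have h : (n.factorial : ℝ) ≠ 0 := by positivity
  have h' : (n : ℝ) + 1 ≠ 0 := by positivity
  rw [binomSeriesCoeff, binomSeriesCoeff, ascPochhammer_succ_right, Nat.factorial_succ]
  push_cast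
  simp only [eval_mul, eval_add, eval_X, eval_natCast]
  field_simp

lemma binomSeriesCoeff_eq_Gamma {c : ℝ} (hc : 0 < c) (n : ℕ) :
    binomSeriesCoeff c n = Real.Gamma (c + n) / (Real.Gamma c * (n.factorial : ℝ)) := by
  have hG : Real.Gamma c ≠ 0 := (Real.Gamma_pos_of_pos hc).ne'
  induction n with
  | zero => simp [binomSeriesCoeff_zero, hG]
  | succ n ih =>
    have h := succ_mul_binomSeriesCoeff_succ c n
    have hn : (n : ℝ) + 1 ≠ 0 := by positivity
    have hf : (n.factorial : ℝ) ≠ 0 := by positivity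
    have hg : Real.Gamma (c + (n + 1 : ℕ)) = (c + n) * Real.Gamma (c + n) := by
      rw [← Real.Gamma_add_one (by positivity)]
      push_cast
      ring_nf
    rw [hg, Nat.factorial_succ]
    rw [ih] at h
    push_cast
    field_simp at h ⊢
    linear_combination h

/-- The polynomials with generating function
`∑ P_m(x) z ^ m = (1 - z) ^ (a - 1) * (1 - x z) ^ (1 - a - b)`. -/
noncomputable def momentPoly (a b : ℝ) (m : ℕ) : ℝ[X] :=
  ∑ j ∈ Finset.range (m + 1),
    C (binomSeriesCoeff (1 - a) (m - j) * binomSeriesCoeff (a + b - 1) j) * X ^ j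

lemma momentPoly_coeff (a b : ℝ) (m j : ℕ) :
    (momentPoly a b m).coeff j = if j ≤ m then
      binomSeriesCoeff (1 - a) (m - j) * binomSeriesCoeff (a + b - 1) j else 0 := by
  simp only [momentPoly, finsetSum_coeff, coeff_C_mul, coeff_X_pow, mul_ite, mul_one, mul_zero,
    Finset.sum_ite_eq, Finset.mem_range, Nat.lt_succ_iff]

lemma momentPoly_zero (a b : ℝ) : momentPoly a b 0 = 1 := by
  simp [momentPoly, binomSeriesCoeff_zero]

lemma derivative_momentPoly_succ (a b : ℝ) (m : ℕ) :
    derivative (momentPoly a b (m + 1)) =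
      X * derivative (momentPoly a b m) + C (a + b - 1) * momentPoly a b m := by
  ext j
  have h := succ_mul_binomSeriesCoeff_succ (a + b - 1) j
  have e : m + 1 - (j + 1) = m - j := by omega
  rcases j with _ | j
  · simp only [coeff_derivative, coeff_add, mul_coeff_zero, coeff_X_zero, coeff_C_zero,
      momentPoly_coeff]
    simp [binomSeriesCoeff_zero] at h ⊢
    rw [h]
    ring
  · simp only [coeff_derivative, coeff_add, coeff_C_mul, coeff_X_mul, momentPoly_coeff, e]
    by_cases hj : j + 1 ≤ m
    · rw [if_pos (by omega), if_pos hj]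
      push_cast at h ⊢
      linear_combination binomSeriesCoeff (1 - a) (m - (j + 1)) * h
    · rw [if_neg (by omega), if_neg hj]
      ring

lemma momentPoly_three_term (a b : ℝ) (m : ℕ) :
    C (b + m) * momentPoly a b m =
      (1 - X) * derivative (momentPoly a b (m + 1)) +
        C ((m : ℝ) + 1) * momentPoly a b (m + 1) := by
  have key : C (b + m) * momentPoly a b m =
      derivative (momentPoly a b (m + 1)) - X * derivative (momentPoly a b (m + 1)) +
        C ((m : ℝ) + 1) * momentPoly a b (m + 1) := by
    nth_rewrite 1 [derivative_momentPoly_succ]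
    ext j
    have hjX : ∀ p : ℝ[X], (X * derivative p).coeff j = j * p.coeff j := by
      intro p
      rcases j with _ | j
      · simp
      · rw [coeff_X_mul, coeff_derivative]
        push_cast
        ring
    simp only [coeff_add, coeff_sub, coeff_C_mul, hjX, momentPoly_coeff]
    rcases lt_trichotomy j (m + 1) with hj | hj | hj
    · obtain ⟨i, rfl⟩ := Nat.exists_eq_add_of_le (Nat.lt_succ_iff.mp hj)
      have h := succ_mul_binomSeriesCoeff_succ (1 - a) i
      have e1 : j + i - j = i := by omega
      have e2 : j + i + 1 - j = i + 1 := by omega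
      rw [if_pos (by omega), if_pos (by omega), e1, e2]
      push_cast
      linear_combination -binomSeriesCoeff (a + b - 1) j * h
    · subst hj
      simp
    · rw [if_neg (by omega), if_neg (by omega)]
      ring
  rw [key]
  ring

/-- The linear map `X ^ m ↦ momentPoly a b m`. -/
noncomputable def momentMap (a b : ℝ) : ℝ[X] →ₗ[ℝ] ℝ[X] :=
  Polynomial.lsum fun m => LinearMap.toSpanSingleton ℝ ℝ[X] (momentPoly a b m)

lemma momentMap_monomial (a b : ℝ) (m : ℕ) (c : ℝ) :
    momentMap a b (monomial m c) = C c * momentPoly a b m := by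
  simp [momentMap, smul_eq_C_mul]

lemma momentMap_X_pow (a b : ℝ) (m : ℕ) : momentMap a b (X ^ m) = momentPoly a b m := by
  rw [← monomial_one_right_eq_X_pow, momentMap_monomial, C_1, one_mul]

lemma momentMap_C_mul (a b c : ℝ) (p : ℝ[X]) :
    momentMap a b (C c * p) = C c * momentMap a b p := by
  rw [← smul_eq_C_mul, map_smul, smul_eq_C_mul]

/-- The first order raising operator of the Jacobi weight `(1 - x) ^ a * x ^ b`. -/
noncomputable def raiseOp (a b : ℝ) (p : ℝ[X]) : ℝ[X] :=
  X * (1 - X) * derivative p + (C b * (1 - X) - C a * X) * p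

lemma raiseOp_add (a b : ℝ) (p q : ℝ[X]) :
    raiseOp a b (p + q) = raiseOp a b p + raiseOp a b q := by
  simp only [raiseOp, derivative_add]
  ring

lemma raiseOp_C_mul (a b c : ℝ) (p : ℝ[X]) :
    raiseOp a b (C c * p) = C c * raiseOp a b p := by
  simp only [raiseOp, derivative_C_mul]
  ring

lemma X_mul_derivative_X_pow (m : ℕ) :
    X * derivative (X ^ m : ℝ[X]) = C (m : ℝ) * X ^ m := by
  rcases m with _ | m
  · simp
  · rw [derivative_X_pow]
    simp only [Nat.add_sub_cancel]
    ring

lemma raiseOp_X_pow (a b : ℝ) (m : ℕ) :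
    raiseOp a b (X ^ m) = C (b + m) * X ^ m - C (a + b + m) * X ^ (m + 1) := by
  have h := X_mul_derivative_X_pow m
  simp only [raiseOp, C_add]
  linear_combination (1 - X) * h

lemma momentMap_raiseOp (a b : ℝ) (p : ℝ[X]) :
    momentMap a b (raiseOp a b p) = derivative (momentMap a b (X * (1 - X) * p)) := by
  induction p using Polynomial.induction_on' with
  | add p q hp hq => rw [raiseOp_add, map_add, hp, hq, mul_add, map_add, derivative_add]
  | monomial m c =>
    have e : X * (1 - X) * (C c * X ^ m) = C c * (X ^ (m + 1) - X ^ (m + 2) : ℝ[X]) := by ring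
    rw [← C_mul_X_pow_eq_monomial, raiseOp_C_mul, momentMap_C_mul, e, momentMap_C_mul,
      raiseOp_X_pow, map_sub, map_sub, momentMap_C_mul, momentMap_C_mul, derivative_C_mul,
      derivative_sub]
    simp only [momentMap_X_pow]
    have h1 := momentPoly_three_term a b m
    have h2 := derivative_momentPoly_succ a b (m + 1)
    simp only [C_add, C_sub, C_1] at h1 h2 ⊢
    linear_combination C c * h1 + C c * h2

lemma momentMap_raiseOp_derivative (a b : ℝ) (p : ℝ[X]) :
    momentMap a b (raiseOp a b (derivative p)) =
      raiseOp b a (derivative (momentMap a b p)) := by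
  induction p using Polynomial.induction_on' with
  | add p q hp hq => simp only [raiseOp_add, map_add, hp, hq]
  | monomial m c =>
    rw [← C_mul_X_pow_eq_monomial, derivative_C_mul, raiseOp_C_mul, momentMap_C_mul,
      momentMap_C_mul, derivative_C_mul, raiseOp_C_mul, momentMap_X_pow]
    congr 1
    rcases m with _ | m
    · simp [momentPoly_zero, raiseOp]
    · rw [derivative_X_pow, raiseOp_C_mul, momentMap_C_mul, Nat.add_sub_cancel, raiseOp_X_pow,
        map_sub, momentMap_C_mul, momentMap_C_mul, momentMap_X_pow, momentMap_X_pow]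
      have h1 := momentPoly_three_term a b m
      have h2 := derivative_momentPoly_succ a b m
      have h3 := congrArg derivative h1
      simp only [derivative_add, derivative_sub, derivative_mul, derivative_C, derivative_one,
        derivative_X, zero_mul, zero_add] at h3
      simp only [raiseOp, C_add, C_sub, C_1, Nat.cast_add, Nat.cast_one] at h1 h2 h3 ⊢
      linear_combination (C a + C b + C (m : ℝ)) * h1 + (C b + C (m : ℝ)) * h2 + X * h3

lemma momentMap_coeff_of_natDegree_le (a b : ℝ) {n : ℕ} {p : ℝ[X]} (hp : p.natDegree ≤ n) :
    (momentMap a b p).natDegree ≤ n ∧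
      (momentMap a b p).coeff n = binomSeriesCoeff (a + b - 1) n * p.coeff n := by
  have hc : ∀ j, (momentMap a b p).coeff j =
      ∑ m ∈ Finset.range (n + 1), p.coeff m * (momentPoly a b m).coeff j := by
    intro j
    conv_lhs => rw [p.as_sum_range' (n + 1) (by omega)]
    simp only [map_sum, momentMap_monomial, finsetSum_coeff, coeff_C_mul]
  constructor
  · rw [natDegree_le_iff_coeff_eq_zero]
    intro j hj
    rw [hc]
    refine Finset.sum_eq_zero fun m hm => ?_
    have := Finset.mem_range.mp hm
    rw [momentPoly_coeff, if_neg (by omega), mul_zero]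
  · rw [hc, Finset.sum_range_succ, Finset.sum_eq_zero, momentPoly_coeff]
    · simp [binomSeriesCoeff_zero, mul_comm]
    · intro m hm
      have := Finset.mem_range.mp hm
      rw [momentPoly_coeff, if_neg (by omega), mul_zero]

lemma coeff_raiseOp_derivative_natDegree (a b : ℝ) (p : ℝ[X]) :
    (raiseOp a b (derivative p)).coeff p.natDegree =
      -((p.natDegree : ℝ) * (p.natDegree + a + b - 1)) * p.coeff p.natDegree := by
  have hz : p.coeff (p.natDegree + 1) = 0 := coeff_eq_zero_of_natDegree_lt (Nat.lt_succ_self _)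
  have e : raiseOp a b (derivative p) =
      X * derivative (derivative p) - X * (X * derivative (derivative p)) +
        (C b * derivative p - C (a + b) * (X * derivative p)) := by
    simp only [raiseOp, C_add]
    ring
  rw [e]
  generalize p.natDegree = d at hz
  rcases d with _ | _ | d
  · simp at hz
    simp [coeff_derivative, hz]
  · simp only [coeff_add, coeff_sub, coeff_X_mul, coeff_C_mul, coeff_derivative, mul_coeff_zero,
      coeff_X_zero, hz]
    push_cast
    ring
  · simp only [coeff_add, coeff_sub, coeff_X_mul, coeff_C_mul, coeff_derivative, hz]
    push_cast
    ring

/-- Uniqueness of polynomial solutions of the Jacobi equation of degree below `n`. -/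
lemma eq_zero_of_jacobi_equation {a b : ℝ} (hab : 1 < a + b) {n : ℕ} {p : ℝ[X]}
    (hp : p.natDegree ≤ n) (hn : p.coeff n = 0)
    (h : raiseOp a b (derivative p) = C (-((n : ℝ) * (n + a + b - 1))) * p) : p = 0 := by
  by_contra hne
  have hlc : p.coeff p.natDegree ≠ 0 := by simpa using hne
  have hlt : p.natDegree < n := lt_of_le_of_ne hp fun e => hlc (by rw [e, hn])
  have h1 := coeff_raiseOp_derivative_natDegree a b p
  rw [h, coeff_C_mul] at h1
  have h2 := mul_right_cancel₀ hlc h1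
  have h3 : (p.natDegree : ℝ) < n := by exact_mod_cast hlt
  have h4 : (0 : ℝ) ≤ p.natDegree := by positivity
  nlinarith

/-- The coefficient of `t ^ m * (t - 1) ^ (n - m)` in the shifted Jacobi polynomial. -/
noncomputable def jacobiCoeff (a b : ℝ) (n m : ℕ) : ℝ :=
  Real.Gamma ((n : ℝ) + a + 1) /
      (Real.Gamma ((m : ℝ) + 1) * Real.Gamma ((n : ℝ) + a - (m : ℝ) + 1)) *
    (Real.Gamma ((n : ℝ) + b + 1) /
      (Real.Gamma ((n : ℝ) - (m : ℝ) + 1) * Real.Gamma (b + (m : ℝ) + 1)))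

/-- The shifted Jacobi polynomial as a formal polynomial. -/
noncomputable def jacobiPoly (a b : ℝ) (n : ℕ) : ℝ[X] :=
  ∑ m ∈ Finset.range (n + 1), C (jacobiCoeff a b n m) * (X ^ m * (X - 1) ^ (n - m))

lemma jacobiPoly_natDegree_le (a b : ℝ) (n : ℕ) : (jacobiPoly a b n).natDegree ≤ n := by
  refine natDegree_sum_le_of_forall_le _ _ fun m hm => ?_
  have := Finset.mem_range.mp hm
  refine (natDegree_C_mul_le _ _).trans ?_
  rw [← C_1, natDegree_mul (pow_ne_zero _ X_ne_zero) (pow_ne_zero _ (X_sub_C_ne_zero _)),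
    natDegree_X_pow, natDegree_pow, natDegree_X_sub_C]
  omega

lemma jacobiPoly_coeff_self (a b : ℝ) (n : ℕ) :
    (jacobiPoly a b n).coeff n = ∑ m ∈ Finset.range (n + 1), jacobiCoeff a b n m := by
  rw [jacobiPoly, finsetSum_coeff]
  refine Finset.sum_congr rfl fun m hm => ?_
  have := Finset.mem_range.mp hm
  have hmon : (X ^ m * (X - 1) ^ (n - m) : ℝ[X]).Monic := by
    rw [← C_1]
    exact (monic_X_pow m).mul ((monic_X_sub_C 1).pow _)
  have hdeg : (X ^ m * (X - 1) ^ (n - m) : ℝ[X]).natDegree = n := by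
    rw [← C_1, natDegree_mul (pow_ne_zero _ X_ne_zero) (pow_ne_zero _ (X_sub_C_ne_zero _)),
      natDegree_X_pow, natDegree_pow, natDegree_X_sub_C]
    omega
  have := hmon.coeff_natDegree
  rw [hdeg] at this
  rw [coeff_C_mul, this, mul_one]

lemma jacobiPoly_coeff_self_comm (a b : ℝ) (n : ℕ) :
    (jacobiPoly a b n).coeff n = (jacobiPoly b a n).coeff n := by
  rw [jacobiPoly_coeff_self, jacobiPoly_coeff_self, ← Finset.sum_range_reflect]
  refine Finset.sum_congr rfl fun m hm => ?_
  have hm' : m ≤ n := Nat.lt_succ_iff.mp (Finset.mem_range.mp hm)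
  have e : n + 1 - 1 - m = n - m := by omega
  rw [e, jacobiCoeff, jacobiCoeff, Nat.cast_sub hm']
  have e1 : (n : ℝ) + a - (n - m) + 1 = a + m + 1 := by ring
  have e2 : (n : ℝ) - (n - m) + 1 = m + 1 := by ring
  have e3 : b + ((n : ℝ) - m) + 1 = n + b - m + 1 := by ring
  rw [e1, e2, e3]
  simp only [div_eq_mul_inv, mul_inv]
  ring

lemma jacobiCoeff_mul_add {a b : ℝ} (hb : 0 < b) {n m : ℕ} (hm : m ≤ n) :
    (b + m) * jacobiCoeff a b n m =
      ((n : ℝ) + 1 - m) * jacobiCoeff (a - 1) (b - 1) (n + 1) m := by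
  have hmn : (m : ℝ) ≤ n := by exact_mod_cast hm
  have hbm : 0 < b + m := by positivity
  have hnm : 0 < (n : ℝ) - m + 1 := by linarith
  have h1 : Real.Gamma (b + m + 1) = (b + m) * Real.Gamma (b + m) := Real.Gamma_add_one hbm.ne'
  have h2 : Real.Gamma ((n : ℝ) - m + 1 + 1) = (n - m + 1) * Real.Gamma (n - m + 1) :=
    Real.Gamma_add_one hnm.ne'
  have e1 : ((n + 1 : ℕ) : ℝ) + (a - 1) + 1 = n + a + 1 := by push_cast; ring
  have e2 : ((n + 1 : ℕ) : ℝ) + (a - 1) - m + 1 = n + a - m + 1 := by push_cast; ring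
  have e3 : ((n + 1 : ℕ) : ℝ) + (b - 1) + 1 = n + b + 1 := by push_cast; ring
  have e4 : ((n + 1 : ℕ) : ℝ) - m + 1 = n - m + 1 + 1 := by push_cast; ring
  have e5 : b - 1 + (m : ℝ) + 1 = b + m := by ring
  have e6 : (n : ℝ) + 1 - m = n - m + 1 := by ring
  rw [jacobiCoeff, jacobiCoeff, e1, e2, e3, e4, e5, e6, h1, h2]
  have g1 := (Real.Gamma_pos_of_pos hbm).ne'
  have g2 := (Real.Gamma_pos_of_pos hnm).ne'
  have g3 := hbm.ne'
  have g4 := hnm.ne'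
  rw [mul_left_comm, mul_left_comm ((n : ℝ) - m + 1)]
  congr 1
  field_simp

lemma jacobiCoeff_succ_mul {a b : ℝ} (ha : 0 < a) {n m : ℕ} (hm : m ≤ n) :
    ((m : ℝ) + 1) * jacobiCoeff (a - 1) (b - 1) (n + 1) (m + 1) =
      (a + n - m) * jacobiCoeff a b n m := by
  have hmn : (m : ℝ) ≤ n := by exact_mod_cast hm
  have ham : 0 < (n : ℝ) + a - m := by linarith
  have hm1 : 0 < (m : ℝ) + 1 := by positivity
  have h1 : Real.Gamma ((n : ℝ) + a - m + 1) = (n + a - m) * Real.Gamma (n + a - m) :=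
    Real.Gamma_add_one ham.ne'
  have h2 : Real.Gamma ((m : ℝ) + 1 + 1) = (m + 1) * Real.Gamma (m + 1) :=
    Real.Gamma_add_one hm1.ne'
  have e1 : ((n + 1 : ℕ) : ℝ) + (a - 1) + 1 = n + a + 1 := by push_cast; ring
  have e2 : ((n + 1 : ℕ) : ℝ) + (a - 1) - (m + 1 : ℕ) + 1 = n + a - m := by push_cast; ring
  have e3 : ((n + 1 : ℕ) : ℝ) + (b - 1) + 1 = n + b + 1 := by push_cast; ring
  have e4 : ((n + 1 : ℕ) : ℝ) - (m + 1 : ℕ) + 1 = n - m + 1 := by push_cast; ring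
  have e5 : b - 1 + ((m + 1 : ℕ) : ℝ) + 1 = b + m + 1 := by push_cast; ring
  have e6 : a + (n : ℝ) - m = n + a - m := by ring
  have e7 : ((m + 1 : ℕ) : ℝ) + 1 = m + 1 + 1 := by push_cast; ring
  rw [jacobiCoeff, jacobiCoeff, e1, e2, e3, e4, e5, e6, e7, h1, h2]
  have g1 := (Real.Gamma_pos_of_pos ham).ne'
  have g2 := (Real.Gamma_pos_of_pos hm1).ne'
  have g3 := ham.ne'
  have g4 := hm1.ne'
  rw [← mul_assoc, ← mul_assoc]
  congr 1
  field_simp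

lemma derivative_X_sub_one_pow (l : ℕ) :
    derivative ((X - 1 : ℝ[X]) ^ l) = C (l : ℝ) * (X - 1) ^ (l - 1) := by
  rw [← C_1, derivative_X_sub_C_pow]

lemma X_sub_one_mul_derivative_pow (l : ℕ) :
    (X - 1) * derivative ((X - 1 : ℝ[X]) ^ l) = C (l : ℝ) * (X - 1) ^ l := by
  rcases l with _ | l
  · simp
  · rw [derivative_X_sub_one_pow, Nat.add_sub_cancel]
    ring

lemma raiseOp_sum (a b : ℝ) {ι : Type*} (s : Finset ι) (p : ι → ℝ[X]) :
    raiseOp a b (∑ i ∈ s, p i) = ∑ i ∈ s, raiseOp a b (p i) := by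
  simp only [raiseOp, derivative_sum, Finset.mul_sum, Finset.sum_add_distrib]

lemma raiseOp_X_pow_mul (a b : ℝ) (m l : ℕ) :
    raiseOp a b (X ^ m * (X - 1) ^ l) =
      -(C (b + m) * (X ^ m * (X - 1) ^ (l + 1)) + C (a + l) * (X ^ (m + 1) * (X - 1) ^ l)) := by
  have h1 := X_mul_derivative_X_pow m
  have h2 := X_sub_one_mul_derivative_pow l
  simp only [raiseOp, derivative_mul, C_add]
  linear_combination (1 - X) * (X - 1) ^ l * h1 - X * X ^ m * h2

lemma raiseOp_jacobiPoly {a b : ℝ} (ha : 0 < a) (hb : 0 < b) (n : ℕ) :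
    raiseOp a b (jacobiPoly a b n) =
      C (-((n : ℝ) + 1)) * jacobiPoly (a - 1) (b - 1) (n + 1) := by
  have hleft : raiseOp a b (jacobiPoly a b n) = ∑ m ∈ Finset.range (n + 1),
      -(C (((n : ℝ) + 1 - m) * jacobiCoeff (a - 1) (b - 1) (n + 1) m) *
          (X ^ m * (X - 1) ^ (n + 1 - m)) +
        C (((m + 1 : ℕ) : ℝ) * jacobiCoeff (a - 1) (b - 1) (n + 1) (m + 1)) *
          (X ^ (m + 1) * (X - 1) ^ (n + 1 - (m + 1)))) := by
    rw [jacobiPoly, raiseOp_sum]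
    refine Finset.sum_congr rfl fun m hm => ?_
    have hm' : m ≤ n := Nat.lt_succ_iff.mp (Finset.mem_range.mp hm)
    have e1 : n - m + 1 = n + 1 - m := by omega
    have e2 : n + 1 - (m + 1) = n - m := by omega
    rw [raiseOp_C_mul, raiseOp_X_pow_mul, ← jacobiCoeff_mul_add hb hm', Nat.cast_succ,
      jacobiCoeff_succ_mul ha hm', e1, e2, Nat.cast_sub hm']
    simp only [C_mul, C_add, C_sub]
    ring
  have h1 : ∑ m ∈ Finset.range (n + 1 + 1),
      C (((n : ℝ) + 1 - m) * jacobiCoeff (a - 1) (b - 1) (n + 1) m) *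
          (X ^ m * (X - 1) ^ (n + 1 - m)) = ∑ m ∈ Finset.range (n + 1),
      C (((n : ℝ) + 1 - m) * jacobiCoeff (a - 1) (b - 1) (n + 1) m) *
          (X ^ m * (X - 1) ^ (n + 1 - m)) := by
    rw [Finset.sum_range_succ]
    simp
  have h2 : ∑ m ∈ Finset.range (n + 1 + 1),
      C ((m : ℝ) * jacobiCoeff (a - 1) (b - 1) (n + 1) m) *
          (X ^ m * (X - 1) ^ (n + 1 - m)) = ∑ m ∈ Finset.range (n + 1),
      C (((m + 1 : ℕ) : ℝ) * jacobiCoeff (a - 1) (b - 1) (n + 1) (m + 1)) *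
          (X ^ (m + 1) * (X - 1) ^ (n + 1 - (m + 1))) := by
    rw [Finset.sum_range_succ']
    simp
  rw [hleft, Finset.sum_neg_distrib, Finset.sum_add_distrib, ← h1, ← h2,
    ← Finset.sum_add_distrib, jacobiPoly, Finset.mul_sum, ← Finset.sum_neg_distrib]
  refine Finset.sum_congr rfl fun m _ => ?_
  simp only [C_mul, C_add, C_sub, C_neg]
  ring

lemma derivative_jacobiPoly {a b : ℝ} (ha : 0 < a) (hb : 0 < b) (n : ℕ) :
    derivative (jacobiPoly (a - 1) (b - 1) (n + 1)) =
      C ((n : ℝ) + a + b) * jacobiPoly a b n := by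
  have h : derivative (jacobiPoly (a - 1) (b - 1) (n + 1)) =
      ∑ m ∈ Finset.range (n + 1 + 1),
        C ((m : ℝ) * jacobiCoeff (a - 1) (b - 1) (n + 1) m) *
          (X ^ (m - 1) * (X - 1) ^ (n + 1 - m)) +
      ∑ m ∈ Finset.range (n + 1 + 1),
        C (((n + 1 - m : ℕ) : ℝ) * jacobiCoeff (a - 1) (b - 1) (n + 1) m) *
          (X ^ m * (X - 1) ^ (n + 1 - m - 1)) := by
    rw [jacobiPoly, derivative_sum, ← Finset.sum_add_distrib]
    refine Finset.sum_congr rfl fun m _ => ?_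
    rw [derivative_C_mul, derivative_mul, derivative_X_sub_one_pow, derivative_X_pow]
    simp only [C_mul]
    ring
  rw [h, Finset.sum_range_succ', Finset.sum_range_succ _ (n + 1), jacobiPoly, Finset.mul_sum]
  simp only [Nat.cast_zero, zero_mul, C_0, add_zero, Nat.sub_self]
  rw [← Finset.sum_add_distrib]
  refine Finset.sum_congr rfl fun m hm => ?_
  have hm' : m ≤ n := Nat.lt_succ_iff.mp (Finset.mem_range.mp hm)
  have e1 : m + 1 - 1 = m := by omega
  have e2 : n + 1 - (m + 1) = n - m := by omega
  have e3 : n + 1 - m - 1 = n - m := by omega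
  have e4 : ((n + 1 - m : ℕ) : ℝ) = n + 1 - m := by
    rw [Nat.cast_sub (by omega)]
    push_cast
    ring
  rw [e1, e2, e3, e4, ← jacobiCoeff_mul_add hb hm', Nat.cast_succ, jacobiCoeff_succ_mul ha hm']
  simp only [C_mul, C_add, C_sub]
  ring

/-- The Jacobi differential equation. -/
lemma jacobiPoly_equation {a b : ℝ} (ha : 0 < a) (hb : 0 < b) (n : ℕ) :
    raiseOp a b (derivative (jacobiPoly (a - 1) (b - 1) n)) =
      C (-((n : ℝ) * (n + a + b - 1))) * jacobiPoly (a - 1) (b - 1) n := by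
  rcases n with _ | n
  · simp [jacobiPoly, raiseOp]
  · rw [derivative_jacobiPoly ha hb, raiseOp_C_mul, raiseOp_jacobiPoly ha hb, ← mul_assoc, ← C_mul]
    push_cast
    ring_nf

lemma momentMap_jacobiPoly {a b : ℝ} (ha : 0 < a) (hb : 0 < b) (hab : 1 < a + b) (n : ℕ) :
    momentMap a b (jacobiPoly (a - 1) (b - 1) n) =
      C (binomSeriesCoeff (a + b - 1) n) * jacobiPoly (b - 1) (a - 1) n := by
  obtain ⟨hd, hc⟩ := momentMap_coeff_of_natDegree_le a b (jacobiPoly_natDegree_le (a - 1) (b - 1) n)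
  rw [← sub_eq_zero]
  refine eq_zero_of_jacobi_equation (a := b) (b := a) (n := n) (by linarith) ?_ ?_ ?_
  · exact (natDegree_sub_le _ _).trans
      (max_le hd ((natDegree_C_mul_le _ _).trans (jacobiPoly_natDegree_le _ _ n)))
  · rw [coeff_sub, hc, coeff_C_mul, jacobiPoly_coeff_self_comm, sub_self]
  · have e : ∀ p q : ℝ[X], raiseOp b a (p - q) = raiseOp b a p - raiseOp b a q := by
      intro p q
      simp only [raiseOp, derivative_sub]
      ring
    rw [derivative_sub, e, ← momentMap_raiseOp_derivative, jacobiPoly_equation ha hb,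
      derivative_C_mul, raiseOp_C_mul, jacobiPoly_equation hb ha, momentMap_C_mul]
    simp only [C_neg, C_mul, C_add, C_sub]
    ring

lemma derivative_momentMap_jacobiPoly {a b : ℝ} (ha : 0 < a) (hb : 0 < b) (hab : 1 < a + b)
    (n : ℕ) :
    derivative (momentMap a b (X * (1 - X) * jacobiPoly a b n)) =
      C (-(((n : ℝ) + 1) * binomSeriesCoeff (a + b - 1) (n + 1))) *
        jacobiPoly (b - 1) (a - 1) (n + 1) := by
  rw [← momentMap_raiseOp, raiseOp_jacobiPoly ha hb, momentMap_C_mul,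
    momentMap_jacobiPoly ha hb hab, ← mul_assoc, ← C_mul, neg_mul]

lemma derivative_momentMap_X (a b : ℝ) : derivative (momentMap a b X) = C (a + b - 1) := by
  rw [← pow_one X, momentMap_X_pow, derivative_momentPoly_succ, momentPoly_zero]
  simp

lemma rpow_mul_one_sub_rpow_eqOn_re (u v : ℝ) :
    Set.EqOn (fun t : ℝ => ((t : ℂ) ^ ((u : ℂ) - 1) * (1 - (t : ℂ)) ^ ((v : ℂ) - 1)))
      (fun t : ℝ => ((t ^ (u - 1) * (1 - t) ^ (v - 1) : ℝ) : ℂ)) (Set.uIoo 0 1) := by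
  intro t ht
  rw [Set.uIoo_of_le zero_le_one] at ht
  have h1 : (1 - (t : ℂ)) = ((1 - t : ℝ) : ℂ) := by push_cast; ring
  beta_reduce
  rw [h1, ← Complex.ofReal_one, ← Complex.ofReal_sub, ← Complex.ofReal_sub,
    ← Complex.ofReal_cpow ht.1.le, ← Complex.ofReal_cpow (by linarith [ht.2]), Complex.ofReal_mul]

lemma intervalIntegrable_beta {p s : ℝ} (hp : -1 < p) (hs : -1 < s) :
    IntervalIntegrable (fun t : ℝ => t ^ p * (1 - t) ^ s) volume 0 1 := by
  have h := Complex.betaIntegral_convergent (u := ((p + 1 : ℝ) : ℂ)) (v := ((s + 1 : ℝ) : ℂ))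
    (by rw [Complex.ofReal_re]; linarith) (by rw [Complex.ofReal_re]; linarith)
  have h2 := h.congr_uIoo (rpow_mul_one_sub_rpow_eqOn_re (p + 1) (s + 1))
  rw [intervalIntegrable_iff] at h2 ⊢
  simpa [IntegrableOn] using h2.re

lemma integral_beta {p s : ℝ} (hp : -1 < p) (hs : -1 < s) :
    ∫ t in (0 : ℝ)..1, t ^ p * (1 - t) ^ s =
      Real.Gamma (p + 1) * Real.Gamma (s + 1) / Real.Gamma (p + s + 2) := by
  have h := Complex.betaIntegral_eq_Gamma_mul_div ((p + 1 : ℝ) : ℂ) ((s + 1 : ℝ) : ℂ)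
    (by rw [Complex.ofReal_re]; linarith) (by rw [Complex.ofReal_re]; linarith)
  rw [Complex.betaIntegral,
    intervalIntegral.integral_congr_uIoo (rpow_mul_one_sub_rpow_eqOn_re (p + 1) (s + 1)),
    intervalIntegral.integral_ofReal, ← Complex.ofReal_add, Complex.Gamma_ofReal,
    Complex.Gamma_ofReal, Complex.Gamma_ofReal] at h
  have h' : ∫ t in (0 : ℝ)..1, t ^ (p + 1 - 1) * (1 - t) ^ (s + 1 - 1) =
      Real.Gamma (p + 1) * Real.Gamma (s + 1) / Real.Gamma (p + 1 + (s + 1)) := by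
    exact_mod_cast h
  have e : p + 1 + (s + 1) = p + s + 2 := by ring
  rw [e] at h'
  simpa using h'

/-- Euler's integral for the hypergeometric function. -/
noncomputable def eulerInt (g p q x : ℝ) : ℝ :=
  ∫ t in (0 : ℝ)..1, t ^ p * (1 - t) ^ (-g) * (1 - x * t) ^ q

lemma one_sub_mul_pos_s10 {x t : ℝ} (hx : x < 1) (ht : t ∈ Set.Icc (0 : ℝ) 1) : 0 < 1 - x * t := by
  rcases le_total x 0 with h | h
  · nlinarith [ht.1]
  · nlinarith [ht.1, ht.2]

lemma continuousOn_one_sub_mul_rpow {x : ℝ} (hx : x < 1) (q : ℝ) :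
    ContinuousOn (fun t : ℝ => (1 - x * t) ^ q) (Set.uIcc 0 1) := by
  rw [Set.uIcc_of_le zero_le_one]
  exact ContinuousOn.rpow_const (by fun_prop) fun t ht => Or.inl (one_sub_mul_pos_s10 hx ht).ne'

lemma intervalIntegrable_eulerInt {g p x : ℝ} (hg : g < 1) (hp : -1 < p) (hx : x < 1) (q : ℝ) :
    IntervalIntegrable (fun t : ℝ => t ^ p * (1 - t) ^ (-g) * (1 - x * t) ^ q) volume 0 1 :=
  (intervalIntegrable_beta hp (by linarith)).mul_continuousOn (continuousOn_one_sub_mul_rpow hx q)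

lemma eulerInt_split {g p x : ℝ} (hg : g < 1) (hp : -1 < p) (hx : x < 1) (q : ℝ) :
    eulerInt g p q x = eulerInt g p (q - 1) x - x * eulerInt g (p + 1) (q - 1) x := by
  have i1 := intervalIntegrable_eulerInt hg hp hx (q - 1)
  have i2 := intervalIntegrable_eulerInt hg (p := p + 1) (by linarith) hx (q - 1)
  rw [eulerInt, eulerInt, eulerInt, ← intervalIntegral.integral_const_mul,
    ← intervalIntegral.integral_sub i1 (i2.const_mul x)]
  refine intervalIntegral.integral_congr_uIoo fun t ht => ?_
  rw [Set.uIoo_of_le zero_le_one] at ht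
  have h1 := one_sub_mul_pos_s10 hx (Set.Ioo_subset_Icc_self ht)
  have e1 : (1 - x * t) ^ q = (1 - x * t) ^ (q - 1) * (1 - x * t) := by
    rw [← Real.rpow_add_one h1.ne', sub_add_cancel]
  rw [e1, Real.rpow_add_one ht.1.ne']
  ring

lemma hasDerivAt_eulerInt {g p x : ℝ} (hg : g < 1) (hp : -1 < p) (hx : x < 1) (q : ℝ) :
    HasDerivAt (eulerInt g p q) (-q * eulerInt g (p + 1) (q - 1) x) x := by
  have hδ : 0 < (1 - x) / 2 := by linarith
  have hball : ∀ y ∈ Metric.closedBall x ((1 - x) / 2), y < 1 := by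
    intro y hy
    rw [Metric.mem_closedBall, Real.dist_eq] at hy
    linarith [le_abs_self (y - x)]
  have hcpt : IsCompact (Metric.closedBall x ((1 - x) / 2) ×ˢ Set.Icc (0 : ℝ) 1) :=
    (isCompact_closedBall _ _).prod isCompact_Icc
  obtain ⟨M, hM⟩ := hcpt.exists_bound_of_continuousOn
    (f := fun z : ℝ × ℝ => q * z.2 * (1 - z.1 * z.2) ^ (q - 1)) (by
      refine ContinuousOn.mul (by fun_prop) (ContinuousOn.rpow_const (by fun_prop) ?_)
      rintro ⟨y, t⟩ ⟨hy, ht⟩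
      exact Or.inl (one_sub_mul_pos_s10 (hball y hy) ht).ne')
  have hb := intervalIntegrable_beta hp (s := -g) (by linarith)
  have key := (intervalIntegral.hasDerivAt_integral_of_dominated_loc_of_deriv_le
    (μ := volume) (a := 0) (b := 1) (x₀ := x) (s := Metric.ball x ((1 - x) / 2))
    (F := fun y t => t ^ p * (1 - t) ^ (-g) * (1 - y * t) ^ q)
    (F' := fun y t => t ^ p * (1 - t) ^ (-g) * (-(q * t * (1 - y * t) ^ (q - 1))))
    (bound := fun t => |t ^ p * (1 - t) ^ (-g)| * M)
    (Metric.ball_mem_nhds _ hδ) ?_ (intervalIntegrable_eulerInt hg hp hx q) ?_ ?_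
    (hb.abs.mul_const M) ?_).2
  · refine key.congr_deriv ?_
    rw [eulerInt, ← intervalIntegral.integral_const_mul]
    refine intervalIntegral.integral_congr_uIoo fun t ht => ?_
    rw [Set.uIoo_of_le zero_le_one] at ht
    rw [Real.rpow_add_one ht.1.ne']
    ring
  · exact Filter.Eventually.of_forall fun y => Measurable.aestronglyMeasurable (by fun_prop)
  · exact Measurable.aestronglyMeasurable (by fun_prop)
  · refine Filter.Eventually.of_forall fun t ht y hy => ?_
    rw [Set.uIoc_of_le zero_le_one] at ht
    rw [norm_mul, norm_neg, Real.norm_eq_abs]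
    exact mul_le_mul_of_nonneg_left
      (hM (y, t) ⟨Metric.ball_subset_closedBall hy, Set.Ioc_subset_Icc_self ht⟩) (abs_nonneg _)
  · refine Filter.Eventually.of_forall fun t ht y hy => ?_
    rw [Set.uIoc_of_le zero_le_one] at ht
    have h1 := one_sub_mul_pos_s10 (hball y (Metric.ball_subset_closedBall hy))
      (Set.Ioc_subset_Icc_self ht)
    have h2 : HasDerivAt (fun y : ℝ => 1 - y * t) (-t) y := by
      simpa using ((hasDerivAt_id y).mul_const t).const_sub 1
    refine ((h2.rpow_const (p := q) (Or.inl h1.ne')).const_mul _).congr_deriv ?_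
    ring

/-- Contiguous relation obtained by integrating the derivative of
`t ^ (p + 1) * (1 - t) ^ (1 - g) * (1 - x t) ^ q`. -/
lemma eulerInt_contiguous {g p x : ℝ} (hg : g < 1) (hp : -1 < p) (hx : x < 1) (q : ℝ) :
    (p + 1) * (eulerInt g p (q - 1) x - (1 + x) * eulerInt g (p + 1) (q - 1) x +
        x * eulerInt g (p + 2) (q - 1) x) -
      (1 - g) * (eulerInt g (p + 1) (q - 1) x - x * eulerInt g (p + 2) (q - 1) x) -
      q * x * (eulerInt g (p + 1) (q - 1) x - eulerInt g (p + 2) (q - 1) x) = 0 := by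
  have i0 := intervalIntegrable_eulerInt hg hp hx (q - 1)
  have i1 := intervalIntegrable_eulerInt hg (p := p + 1) (by linarith) hx (q - 1)
  have i2 := intervalIntegrable_eulerInt hg (p := p + 2) (by linarith) hx (q - 1)
  have j : IntervalIntegrable (fun t : ℝ =>
      (p + 1) * (t ^ p * (1 - t) ^ (-g) * (1 - x * t) ^ (q - 1)) +
      (-((p + 1) * (1 + x) + (1 - g) + q * x)) *
        (t ^ (p + 1) * (1 - t) ^ (-g) * (1 - x * t) ^ (q - 1)) +
      ((p + 1) * x + (1 - g) * x + q * x) *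
        (t ^ (p + 2) * (1 - t) ^ (-g) * (1 - x * t) ^ (q - 1))) volume 0 1 :=
    ((i0.const_mul _).add (i1.const_mul _)).add (i2.const_mul _)
  have ftc := intervalIntegral.integral_eq_sub_of_hasDerivAt_of_le (a := 0) (b := 1)
    (f := fun t : ℝ => t ^ (p + 1) * (1 - t) ^ (1 - g) * (1 - x * t) ^ q)
    zero_le_one ?_ ?_ j
  · rw [intervalIntegral.integral_add ((i0.const_mul _).add (i1.const_mul _)) (i2.const_mul _),
      intervalIntegral.integral_add (i0.const_mul _) (i1.const_mul _),
      intervalIntegral.integral_const_mul, intervalIntegral.integral_const_mul,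
      intervalIntegral.integral_const_mul] at ftc
    rw [sub_self, Real.zero_rpow (by linarith), Real.zero_rpow (by linarith)] at ftc
    simp only [← eulerInt.eq_1] at ftc
    linear_combination ftc
  · have h := continuousOn_one_sub_mul_rpow hx q
    rw [Set.uIcc_of_le zero_le_one] at h
    refine ContinuousOn.mul (ContinuousOn.mul ?_ ?_) h
    · exact continuousOn_id.rpow_const fun _ _ => Or.inr (by linarith)
    · exact ContinuousOn.rpow_const (by fun_prop) fun _ _ => Or.inr (by linarith)
  · intro t ht
    have h1 := one_sub_mul_pos_s10 hx (Set.Ioo_subset_Icc_self ht)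
    have ht0 := ht.1
    have ht1 : 0 < 1 - t := by linarith [ht.2]
    have d1 : HasDerivAt (fun t : ℝ => 1 - x * t) (-x) t := by
      simpa using ((hasDerivAt_id t).const_mul x).const_sub 1
    have d2 : HasDerivAt (fun t : ℝ => 1 - t) (-1) t := by
      simpa using (hasDerivAt_id t).const_sub 1
    refine (((Real.hasDerivAt_rpow_const (p := p + 1) (Or.inl ht0.ne')).mul
      (d2.rpow_const (p := 1 - g) (Or.inl ht1.ne'))).mul
      (d1.rpow_const (p := q) (Or.inl h1.ne'))).congr_deriv ?_
    have e1 : t ^ (p + 2) = t ^ p * t * t := by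
      rw [← Real.rpow_add_one ht0.ne', ← Real.rpow_add_one ht0.ne']
      ring_nf
    have e2 : t ^ (p + 1) = t ^ p * t := Real.rpow_add_one ht0.ne' p
    have e3 : (1 - t) ^ (1 - g) = (1 - t) ^ (-g) * (1 - t) := by
      rw [← Real.rpow_add_one ht1.ne']
      ring_nf
    have e4 : (1 - x * t) ^ q = (1 - x * t) ^ (q - 1) * (1 - x * t) := by
      rw [← Real.rpow_add_one h1.ne', sub_add_cancel]
    have e5 : p + 1 - 1 = p := by ring
    have e6 : 1 - g - 1 = -g := by ring
    simp only [Pi.mul_apply]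
    rw [e5, e6, e1, e2, e3, e4]
    ring

/-- In the degenerate case, where the exponents add up to `-2`, Euler's integral is elementary. -/
lemma eulerInt_degenerate {a b x : ℝ} (hb : 0 < b) (hab : a + b < 2) (hx : x < 1) :
    eulerInt (a + b - 1) (b - 1) (a - 2) x =
      (1 - x) ^ (-b) * (Real.Gamma b * Real.Gamma (2 - a - b) / Real.Gamma (2 - a)) := by
  have hderiv : ∀ y ∈ Set.Iio (1 : ℝ), HasDerivAt
      (fun y => (1 - y) ^ b * eulerInt (a + b - 1) (b - 1) (a - 2) y) 0 y := by
    intro y hy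
    have hy' : 0 < 1 - y := sub_pos.mpr hy
    have d2 : HasDerivAt (fun t : ℝ => 1 - t) (-1) y := by
      simpa using (hasDerivAt_id y).const_sub 1
    have hE := hasDerivAt_eulerInt (g := a + b - 1) (p := b - 1) (by linarith) (by linarith)
      (Set.mem_Iio.mp hy) (a - 2)
    refine ((d2.rpow_const (p := b) (Or.inl hy'.ne')).mul hE).congr_deriv ?_
    have c := eulerInt_contiguous (g := a + b - 1) (p := b - 1) (by linarith) (by linarith)
      (Set.mem_Iio.mp hy) (a - 2)
    have s := eulerInt_split (g := a + b - 1) (p := b - 1) (by linarith) (by linarith)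
      (Set.mem_Iio.mp hy) (a - 2)
    have e : (1 - y) ^ b = (1 - y) ^ (b - 1) * (1 - y) := by
      rw [← Real.rpow_add_one hy'.ne', sub_add_cancel]
    rw [s, e]
    linear_combination -(1 - y) ^ (b - 1) * c
  have hconst := isOpen_Iio.is_const_of_deriv_eq_zero (convex_Iio (1 : ℝ)).isPreconnected
    (fun y hy => (hderiv y hy).differentiableAt.differentiableWithinAt)
    (fun y hy => (hderiv y hy).deriv) (Set.mem_Iio.mpr hx) (Set.mem_Iio.mpr zero_lt_one)
  have h0 : eulerInt (a + b - 1) (b - 1) (a - 2) 0 =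
      Real.Gamma b * Real.Gamma (2 - a - b) / Real.Gamma (2 - a) := by
    have := integral_beta (p := b - 1) (s := -(a + b - 1)) (by linarith) (by linarith)
    simp only [eulerInt, zero_mul, sub_zero, Real.one_rpow, mul_one]
    rw [this]
    ring_nf
  simp only [sub_zero, Real.one_rpow, one_mul, h0] at hconst
  have hx' : 0 < 1 - x := by linarith
  rw [← hconst, ← mul_assoc, ← Real.rpow_add hx']
  simp

/-- The Riemann–Liouville type integral `∫ s in 0..x, s ^ p * (1 - s) ^ q * (x - s) ^ (-g)`. -/
noncomputable def betaRL (g p q x : ℝ) : ℝ := x ^ (p + 1 - g) * eulerInt g p q x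

/-- The derivative of `betaRL`. -/
noncomputable def betaRLDeriv (g p q x : ℝ) : ℝ :=
  x ^ (p - g) * ((p + 1 - g) * eulerInt g p q x - q * x * eulerInt g (p + 1) (q - 1) x)

lemma hasDerivAt_betaRL {g p x : ℝ} (hg : g < 1) (hp : -1 < p) (hx0 : 0 < x) (hx : x < 1)
    (q : ℝ) : HasDerivAt (betaRL g p q) (betaRLDeriv g p q x) x := by
  refine ((Real.hasDerivAt_rpow_const (p := p + 1 - g) (Or.inl hx0.ne')).mul
    (hasDerivAt_eulerInt hg hp hx q)).congr_deriv ?_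
  have e : x ^ (p + 1 - g) = x ^ (p - g) * x := by
    rw [← Real.rpow_add_one hx0.ne']
    ring_nf
  have e' : p + 1 - g - 1 = p - g := by ring
  rw [betaRLDeriv, e, e']
  ring

lemma betaRLDeriv_succ {g p x : ℝ} (hg : g < 1) (hp : -1 < p) (hx0 : 0 < x) (hx : x < 1)
    (q : ℝ) :
    betaRLDeriv g (p + 1) q x = x * betaRLDeriv g p q x + g * betaRL g p q x := by
  have e : x ^ (p + 1 - g) = x ^ (p - g) * x := by
    rw [← Real.rpow_add_one hx0.ne']
    ring_nf
  have c := eulerInt_contiguous hg hp hx q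
  have s0 := eulerInt_split hg hp hx q
  have s1 := eulerInt_split hg (p := p + 1) (by linarith) hx q
  have e2 : p + 1 + 1 = p + 2 := by ring
  rw [e2] at s1
  rw [betaRLDeriv, betaRLDeriv, betaRL, e2, e, s0, s1]
  linear_combination -x ^ (p - g) * x * c

lemma betaRL_split {g p x : ℝ} (hg : g < 1) (hp : -1 < p) (hx0 : 0 < x) (hx : x < 1)
    (q : ℝ) : betaRL g p (q + 1) x = betaRL g p q x - betaRL g (p + 1) q x := by
  have s := eulerInt_split hg hp hx (q + 1)
  have e : x ^ (p + 1 + 1 - g) = x ^ (p + 1 - g) * x := by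
    rw [← Real.rpow_add_one hx0.ne']
    ring_nf
  rw [add_sub_cancel_right] at s
  rw [betaRL, betaRL, betaRL, s, e]
  ring

lemma betaRLDeriv_succ_right {g p x : ℝ} (hg : g < 1) (hp : -1 < p) (hx0 : 0 < x) (hx : x < 1)
    (q : ℝ) :
    betaRLDeriv g p (q + 1) x = (1 - x) * betaRLDeriv g p q x - g * betaRL g p q x := by
  have h1 := hasDerivAt_betaRL hg hp hx0 hx (q + 1)
  have h2 := (hasDerivAt_betaRL hg hp hx0 hx q).sub
    (hasDerivAt_betaRL hg (p := p + 1) (by linarith) hx0 hx q)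
  have h3 := h1.unique (h2.congr_of_eventuallyEq ?_)
  · rw [h3, betaRLDeriv_succ hg hp hx0 hx]
    ring
  · filter_upwards [Ioo_mem_nhds hx0 hx] with y hy
    exact betaRL_split hg hp hy.1 hy.2 q

lemma betaRLDeriv_degenerate {a b x : ℝ} (hb : 0 < b) (hab : a + b < 2) (hx : x < 1) :
    betaRLDeriv (a + b - 1) (b - 1) (a - 1) x = x ^ (-a) * (1 - x) ^ (-b) *
      ((1 - a) * (Real.Gamma b * Real.Gamma (2 - a - b) / Real.Gamma (2 - a))) := by
  have s := eulerInt_split (g := a + b - 1) (p := b - 1) (by linarith) (by linarith) hx (a - 1)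
  have d := eulerInt_degenerate hb hab hx
  have e : a - 1 - 1 = a - 2 := by ring
  have e' : b - 1 - (a + b - 1) = -a := by ring
  rw [e] at s
  rw [betaRLDeriv, s, e, e']
  linear_combination x ^ (-a) * (1 - a) * d

lemma tendsto_eulerInt_one {g p q : ℝ} (hg : g < 1) (hp : -1 < p) (hq : -1 < q - g) :
    Filter.Tendsto (eulerInt g p q) (nhdsWithin 1 (Set.Ioo 0 1))
      (nhds (Real.Gamma (p + 1) * Real.Gamma (q - g + 1) / Real.Gamma (p + (q - g) + 2))) := by
  have hlim : ∫ t in (0 : ℝ)..1, t ^ p * (1 - t) ^ (-g) * (1 - 1 * t) ^ q =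
      Real.Gamma (p + 1) * Real.Gamma (q - g + 1) / Real.Gamma (p + (q - g) + 2) := by
    rw [← integral_beta hp hq]
    refine intervalIntegral.integral_congr_uIoo fun t ht => ?_
    rw [Set.uIoo_of_le zero_le_one] at ht
    rw [one_mul, mul_assoc, ← Real.rpow_add (by linarith [ht.2])]
    ring_nf
  rw [← hlim]
  have hlt : ∀ᵐ t : ℝ, t ≠ 1 := Measure.ae_ne volume 1
  refine intervalIntegral.tendsto_integral_filter_of_dominated_convergence
    (fun t => t ^ p * (1 - t) ^ (q - g) + t ^ p * (1 - t) ^ (-g)) ?_ ?_ ?_ ?_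
  · exact Filter.Eventually.of_forall fun y => Measurable.aestronglyMeasurable (by fun_prop)
  · filter_upwards [self_mem_nhdsWithin] with y hy
    filter_upwards [hlt] with t ht1 ht
    rw [Set.uIoc_of_le zero_le_one] at ht
    have ht' : 0 < 1 - t := sub_pos.mpr (lt_of_le_of_ne ht.2 ht1)
    have hyt : y * t ≤ t := mul_le_of_le_one_left ht.1.le hy.2.le
    have hyt0 : 0 ≤ y * t := mul_nonneg hy.1.le ht.1.le
    have hpos : 0 < 1 - y * t := by linarith
    have h1 : 0 ≤ t ^ p * (1 - t) ^ (-g) :=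
      mul_nonneg (Real.rpow_nonneg ht.1.le _) (Real.rpow_nonneg ht'.le _)
    have h2 : t ^ p * (1 - t) ^ (q - g) = t ^ p * (1 - t) ^ (-g) * (1 - t) ^ q := by
      rw [mul_assoc, ← Real.rpow_add ht']
      ring_nf
    rw [Real.norm_eq_abs, abs_of_nonneg (mul_nonneg h1 (Real.rpow_nonneg hpos.le _)), h2,
      ← mul_add_one]
    refine mul_le_mul_of_nonneg_left ?_ h1
    rcases le_total 0 q with hq0 | hq0
    · have := Real.rpow_le_one hpos.le (by linarith) hq0
      linarith [Real.rpow_nonneg ht'.le q]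
    · have := Real.rpow_le_rpow_of_nonpos ht' (by linarith : 1 - t ≤ 1 - y * t) hq0
      linarith
  · exact (intervalIntegrable_beta hp hq).add (intervalIntegrable_beta hp (by linarith))
  · filter_upwards [hlt] with t ht1 _
    have hc : ContinuousAt (fun y : ℝ => (1 - y * t) ^ q) 1 := by
      refine ContinuousAt.rpow_const (by fun_prop) (Or.inl ?_)
      rw [one_mul]
      exact sub_ne_zero.mpr (Ne.symm ht1)
    exact (hc.tendsto.const_mul _).mono_left nhdsWithin_le_nhds

lemma intervalIntegrable_betaRL {g p x : ℝ} (hg : g < 1) (hp : -1 < p) (hx0 : 0 < x) (hx : x < 1)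
    (q : ℝ) :
    IntervalIntegrable (fun s : ℝ => s ^ p * (1 - s) ^ q * (x - s) ^ (-g)) volume 0 x := by
  have h := ((intervalIntegrable_eulerInt hg hp hx q).const_mul (x ^ p * x ^ (-g))).comp_mul_left
    (c := x⁻¹)
  rw [zero_div, one_div, inv_inv] at h
  refine h.congr_uIoo fun s hs => ?_
  rw [Set.uIoo_of_le hx0.le] at hs
  have e1 : x⁻¹ * s = s / x := by ring
  have e2 : 1 - s / x = (x - s) / x := by field_simp
  have e3 : x * (s / x) = s := by field_simp
  beta_reduce
  rw [e1, e2, e3, Real.div_rpow hs.1.le hx0.le, Real.div_rpow (by linarith [hs.2]) hx0.le]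
  have h1 := (Real.rpow_pos_of_pos hx0 p).ne'
  have h2 := (Real.rpow_pos_of_pos hx0 (-g)).ne'
  field_simp

lemma integral_betaRL {x : ℝ} (hx0 : 0 < x) (g p q : ℝ) :
    ∫ s in (0 : ℝ)..x, s ^ p * (1 - s) ^ q * (x - s) ^ (-g) = betaRL g p q x := by
  have h := intervalIntegral.mul_integral_comp_mul_left (a := 0) (b := 1)
    (f := fun s : ℝ => s ^ p * (1 - s) ^ q * (x - s) ^ (-g)) x
  rw [mul_zero, mul_one] at h
  have e : x ^ (p + 1 - g) = x * (x ^ p * x ^ (-g)) := by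
    rw [← Real.rpow_add hx0, mul_comm, ← Real.rpow_add_one hx0.ne']
    ring_nf
  rw [← h, betaRL, eulerInt, e, mul_assoc x,
    ← intervalIntegral.integral_const_mul (x ^ p * x ^ (-g))]
  congr 1
  refine intervalIntegral.integral_congr_uIoo fun t ht => ?_
  rw [Set.uIoo_of_le zero_le_one] at ht
  have e2 : x - x * t = x * (1 - t) := by ring
  rw [e2, Real.mul_rpow hx0.le ht.1.le, Real.mul_rpow hx0.le (by linarith [ht.2])]
  ring

lemma intervalIntegrable_betaRL_right {g q x : ℝ} (hg : g < 1) (hq : -1 < q) (hx0 : 0 < x)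
    (hx : x < 1) (p : ℝ) :
    IntervalIntegrable (fun s : ℝ => s ^ p * (1 - s) ^ q * (s - x) ^ (-g)) volume x 1 := by
  have h := (intervalIntegrable_betaRL hg hq (sub_pos.mpr hx) (by linarith) p).comp_sub_left 1
  rw [sub_zero, sub_sub_cancel] at h
  refine h.symm.congr_uIoo fun s _ => ?_
  have e : 1 - x - (1 - s) = s - x := by ring
  beta_reduce
  rw [e, sub_sub_cancel, mul_comm (s ^ p)]

lemma integral_betaRL_right {x : ℝ} (hx : x < 1) (g p q : ℝ) :
    ∫ s in x..(1 : ℝ), s ^ p * (1 - s) ^ q * (s - x) ^ (-g) = betaRL g q p (1 - x) := by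
  have h := intervalIntegral.integral_comp_sub_left (a := x) (b := 1)
    (fun s : ℝ => s ^ q * (1 - s) ^ p * (1 - x - s) ^ (-g)) 1
  rw [← integral_betaRL (sub_pos.mpr hx), ← sub_self (1 : ℝ), ← h]
  refine intervalIntegral.integral_congr_uIoo fun s _ => ?_
  have e : 1 - x - (1 - s) = s - x := by ring
  rw [e, sub_sub_cancel, mul_comm (s ^ p)]

/-- The two-sided fractional integral of `s ^ (b - 1 + m) * (1 - s) ^ (a - 1)`, up to a factor. -/
noncomputable def twoSidedBeta (r a b : ℝ) (m : ℕ) (x : ℝ) : ℝ :=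
  r * betaRL (a + b - 1) (b - 1 + m) (a - 1) x +
    (1 - r) * betaRL (a + b - 1) (a - 1) (b - 1 + m) (1 - x)

/-- The derivative of `twoSidedBeta`. -/
noncomputable def twoSidedBetaDeriv (r a b : ℝ) (m : ℕ) (x : ℝ) : ℝ :=
  r * betaRLDeriv (a + b - 1) (b - 1 + m) (a - 1) x -
    (1 - r) * betaRLDeriv (a + b - 1) (a - 1) (b - 1 + m) (1 - x)

lemma hasDerivAt_twoSidedBeta {a b x : ℝ} (r : ℝ) (ha : 0 < a) (hb : 0 < b) (hab : a + b < 2)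
    (m : ℕ) (hx : x ∈ Set.Ioo (0 : ℝ) 1) :
    HasDerivAt (twoSidedBeta r a b m) (twoSidedBetaDeriv r a b m x) x := by
  have hm : (0 : ℝ) ≤ m := m.cast_nonneg
  have h1 := hasDerivAt_betaRL (g := a + b - 1) (p := b - 1 + m) (by linarith) (by linarith)
    hx.1 hx.2 (a - 1)
  have h2 := hasDerivAt_betaRL (g := a + b - 1) (p := a - 1) (x := 1 - x) (by linarith)
    (by linarith) (by linarith [hx.2]) (by linarith [hx.1]) (b - 1 + m)
  have h3 : HasDerivAt (fun x : ℝ => 1 - x) (-1) x := by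
    simpa using (hasDerivAt_id x).const_sub 1
  refine ((h1.const_mul r).add ((h2.comp x h3).const_mul (1 - r))).congr_deriv ?_
  rw [twoSidedBetaDeriv]
  ring

lemma twoSidedBetaDeriv_succ {a b x : ℝ} (r : ℝ) (ha : 0 < a) (hb : 0 < b) (hab : a + b < 2)
    (m : ℕ) (hx : x ∈ Set.Ioo (0 : ℝ) 1) :
    twoSidedBetaDeriv r a b (m + 1) x =
      x * twoSidedBetaDeriv r a b m x + (a + b - 1) * twoSidedBeta r a b m x := by
  have hm : (0 : ℝ) ≤ m := m.cast_nonneg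
  have h1 := betaRLDeriv_succ (g := a + b - 1) (p := b - 1 + m) (by linarith) (by linarith)
    hx.1 hx.2 (a - 1)
  have h2 := betaRLDeriv_succ_right (g := a + b - 1) (p := a - 1) (x := 1 - x) (by linarith)
    (by linarith) (by linarith [hx.2]) (by linarith [hx.1]) (b - 1 + m)
  have e : b - 1 + ((m + 1 : ℕ) : ℝ) = b - 1 + m + 1 := by push_cast; ring
  rw [twoSidedBetaDeriv, twoSidedBetaDeriv, twoSidedBeta, e, h1, h2]
  ring

lemma mul_Gamma_div_Gamma_of_sin {r a b : ℝ} (ha : 0 < a) (ha1 : a < 1) (hb : 0 < b) (hb1 : b ≤ 1)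
    (hr : r * Real.sin (π * a) = (1 - r) * Real.sin (π * b)) :
    r * ((1 - a) * (Real.Gamma b / Real.Gamma (2 - a))) =
      (1 - r) * ((1 - b) * (Real.Gamma a / Real.Gamma (2 - b))) := by
  have hsa : 0 < Real.sin (π * a) :=
    Real.sin_pos_of_pos_of_lt_pi (by positivity) (by nlinarith [Real.pi_pos])
  rcases hb1.eq_or_lt with rfl | hb1
  · rw [mul_one, Real.sin_pi, mul_zero] at hr
    rw [(mul_eq_zero.mp hr).resolve_right hsa.ne']
    ring
  have hsb : 0 < Real.sin (π * b) :=
    Real.sin_pos_of_pos_of_lt_pi (by positivity) (by nlinarith [Real.pi_pos])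
  have ga := Real.Gamma_mul_Gamma_one_sub a
  have gb := Real.Gamma_mul_Gamma_one_sub b
  have pa := Real.Gamma_pos_of_pos (sub_pos.mpr ha1)
  have pb := Real.Gamma_pos_of_pos (sub_pos.mpr hb1)
  have ea : Real.Gamma (2 - a) = (1 - a) * Real.Gamma (1 - a) := by
    rw [← Real.Gamma_add_one (by linarith)]
    ring_nf
  have eb : Real.Gamma (2 - b) = (1 - b) * Real.Gamma (1 - b) := by
    rw [← Real.Gamma_add_one (by linarith)]
    ring_nf
  have na : 1 - a ≠ 0 := by linarith
  have nb : 1 - b ≠ 0 := by linarith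
  rw [eq_div_iff hsa.ne'] at ga
  rw [eq_div_iff hsb.ne'] at gb
  have key : r * (Real.Gamma b * Real.Gamma (1 - b)) =
      (1 - r) * (Real.Gamma a * Real.Gamma (1 - a)) := by
    refine mul_right_cancel₀ (mul_ne_zero hsa.ne' hsb.ne') ?_
    linear_combination r * Real.sin (π * a) * gb - (1 - r) * Real.sin (π * b) * ga + π * hr
  rw [ea, eb]
  field_simp
  linear_combination key

lemma twoSidedBetaDeriv_zero {r a b x : ℝ} (ha : 0 < a) (ha1 : a < 1) (hb : 0 < b) (hb1 : b ≤ 1)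
    (hr : r * Real.sin (π * a) = (1 - r) * Real.sin (π * b)) (hx : x ∈ Set.Ioo (0 : ℝ) 1) :
    twoSidedBetaDeriv r a b 0 x = 0 := by
  have h1 := betaRLDeriv_degenerate hb (a := a) (by linarith) hx.2
  have h2 := betaRLDeriv_degenerate ha (a := b) (x := 1 - x) (by linarith) (by linarith [hx.1])
  have h3 := mul_Gamma_div_Gamma_of_sin ha ha1 hb hb1 hr
  have e : 2 - b - a = 2 - a - b := by ring
  rw [add_comm b a, sub_sub_cancel, e] at h2
  rw [twoSidedBetaDeriv, Nat.cast_zero, add_zero, h1, h2]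
  simp only [div_eq_mul_inv] at h3 ⊢
  linear_combination x ^ (-a) * (1 - x) ^ (-b) * Real.Gamma (2 - a - b) * h3

lemma tendsto_twoSidedBeta_zero {a b : ℝ} (r : ℝ) (ha : 0 < a) (ha1 : a < 1) (hb : 0 < b)
    (hab : a + b < 2) (m : ℕ) :
    Filter.Tendsto (twoSidedBeta r a b m) (nhdsWithin 0 (Set.Ioo 0 1))
      (nhds ((1 - r) * (Real.Gamma a * Real.Gamma (1 - a)) * binomSeriesCoeff (1 - a) m)) := by
  have hm : (0 : ℝ) ≤ m := m.cast_nonneg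
  have h1 : Filter.Tendsto (betaRL (a + b - 1) (b - 1 + m) (a - 1)) (nhdsWithin 0 (Set.Ioo 0 1))
      (nhds 0) := by
    have hc : ContinuousAt (betaRL (a + b - 1) (b - 1 + m) (a - 1)) 0 :=
      (continuousAt_id.rpow_const (Or.inr (by linarith))).mul
        (hasDerivAt_eulerInt (g := a + b - 1) (p := b - 1 + m) (by linarith) (by linarith)
          zero_lt_one (a - 1)).continuousAt
    have hz : betaRL (a + b - 1) (b - 1 + m) (a - 1) 0 = 0 := by
      rw [betaRL, Real.zero_rpow (by linarith), zero_mul]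
    have ht := hc.tendsto
    rw [hz] at ht
    exact ht.mono_left nhdsWithin_le_nhds
  have h2 : Filter.Tendsto (fun x => betaRL (a + b - 1) (a - 1) (b - 1 + m) (1 - x))
      (nhdsWithin 0 (Set.Ioo 0 1))
      (nhds ((Real.Gamma a * Real.Gamma (1 - a)) * binomSeriesCoeff (1 - a) m)) := by
    have hE := tendsto_eulerInt_one (g := a + b - 1) (p := a - 1) (q := b - 1 + m) (by linarith)
      (by linarith) (by linarith)
    have hP : Filter.Tendsto (fun y : ℝ => y ^ (a - 1 + 1 - (a + b - 1)))
        (nhdsWithin 1 (Set.Ioo 0 1)) (nhds 1) := by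
      have hc : ContinuousAt (fun y : ℝ => y ^ (a - 1 + 1 - (a + b - 1))) 1 :=
        continuousAt_id.rpow_const (Or.inl one_ne_zero)
      have := hc.tendsto.mono_left (nhdsWithin_le_nhds (s := Set.Ioo 0 1))
      rwa [Real.one_rpow] at this
    have hS : Filter.Tendsto (fun x : ℝ => 1 - x) (nhdsWithin 0 (Set.Ioo 0 1))
        (nhdsWithin 1 (Set.Ioo 0 1)) := by
      refine tendsto_nhdsWithin_iff.mpr ⟨?_, ?_⟩
      · have hc : Continuous fun x : ℝ => 1 - x := by fun_prop
        simpa using (hc.tendsto 0).mono_left nhdsWithin_le_nhds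
      · filter_upwards [self_mem_nhdsWithin] with x hx
        exact ⟨by linarith [hx.2], by linarith [hx.1]⟩
    have hv : 1 * (Real.Gamma (a - 1 + 1) * Real.Gamma (b - 1 + m - (a + b - 1) + 1) /
        Real.Gamma (a - 1 + (b - 1 + m - (a + b - 1)) + 2)) =
        (Real.Gamma a * Real.Gamma (1 - a)) * binomSeriesCoeff (1 - a) m := by
      have e1 : b - 1 + m - (a + b - 1) + 1 = 1 - a + m := by ring
      have e2 : a - 1 + (b - 1 + m - (a + b - 1)) + 2 = m + 1 := by ring
      have hG := (Real.Gamma_pos_of_pos (sub_pos.mpr ha1)).ne'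
      have hf : (m.factorial : ℝ) ≠ 0 := by positivity
      rw [sub_add_cancel, e1, e2, Real.Gamma_nat_eq_factorial,
        binomSeriesCoeff_eq_Gamma (sub_pos.mpr ha1)]
      field_simp
    rw [← hv]
    exact (hP.mul hE).comp hS
  have h3 := (h1.const_mul r).add (h2.const_mul (1 - r))
  rwa [mul_zero, zero_add, ← mul_assoc] at h3

lemma eq_zero_of_hasDerivAt_of_tendsto {F : ℝ → ℝ}
    (hF : ∀ x ∈ Set.Ioo (0 : ℝ) 1, HasDerivAt F 0 x)
    (h0 : Filter.Tendsto F (nhdsWithin 0 (Set.Ioo 0 1)) (nhds 0)) {x : ℝ}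
    (hx : x ∈ Set.Ioo (0 : ℝ) 1) : F x = 0 := by
  have : (nhdsWithin (0 : ℝ) (Set.Ioo 0 1)).NeBot := left_nhdsWithin_Ioo_neBot zero_lt_one
  refine tendsto_nhds_unique (tendsto_const_nhds.congr' ?_) h0
  filter_upwards [self_mem_nhdsWithin] with y hy
  exact isOpen_Ioo.is_const_of_deriv_eq_zero (convex_Ioo (0 : ℝ) 1).isPreconnected
    (fun z hz => (hF z hz).differentiableAt.differentiableWithinAt)
    (fun z hz => (hF z hz).deriv) hx hy

lemma twoSidedBeta_eq {r a b : ℝ} (ha : 0 < a) (ha1 : a < 1) (hb : 0 < b) (hb1 : b ≤ 1)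
    (hr : r * Real.sin (π * a) = (1 - r) * Real.sin (π * b)) (m : ℕ) :
    ∀ x ∈ Set.Ioo (0 : ℝ) 1, twoSidedBeta r a b m x =
      (1 - r) * (Real.Gamma a * Real.Gamma (1 - a)) * (momentPoly a b m).eval x := by
  set K := (1 - r) * (Real.Gamma a * Real.Gamma (1 - a)) with hK
  have main : ∀ m : ℕ, (∀ x ∈ Set.Ioo (0 : ℝ) 1,
      twoSidedBetaDeriv r a b m x = K * (derivative (momentPoly a b m)).eval x) →
      ∀ x ∈ Set.Ioo (0 : ℝ) 1, twoSidedBeta r a b m x = K * (momentPoly a b m).eval x := by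
    intro m hm x hx
    rw [← sub_eq_zero]
    refine eq_zero_of_hasDerivAt_of_tendsto
      (F := fun x => twoSidedBeta r a b m x - K * (momentPoly a b m).eval x) ?_ ?_ hx
    · intro y hy
      refine ((hasDerivAt_twoSidedBeta r ha hb (by linarith) m hy).sub
        (((momentPoly a b m).hasDerivAt y).const_mul K)).congr_deriv ?_
      rw [hm y hy, sub_self]
    · have h1 := tendsto_twoSidedBeta_zero r ha ha1 hb (by linarith) m
      have h2 := ((momentPoly a b m).continuous.tendsto 0).mono_left
        (nhdsWithin_le_nhds (s := Set.Ioo 0 1))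
      have h3 : (momentPoly a b m).eval 0 = binomSeriesCoeff (1 - a) m := by
        rw [← coeff_zero_eq_eval_zero, momentPoly_coeff]
        simp [binomSeriesCoeff_zero]
      have h4 := h1.sub (h2.const_mul K)
      rwa [h3, sub_self] at h4
  induction m with
  | zero =>
    refine main 0 fun x hx => ?_
    rw [twoSidedBetaDeriv_zero ha ha1 hb hb1 hr hx, momentPoly_zero]
    simp
  | succ m ih =>
    have hD : ∀ x ∈ Set.Ioo (0 : ℝ) 1,
        twoSidedBetaDeriv r a b m x = K * (derivative (momentPoly a b m)).eval x := by
      intro x hx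
      refine (hasDerivAt_twoSidedBeta r ha hb (by linarith) m hx).unique
        ((((momentPoly a b m).hasDerivAt x).const_mul K).congr_of_eventuallyEq ?_)
      filter_upwards [Ioo_mem_nhds hx.1 hx.2] with y hy using ih y hy
    refine main (m + 1) fun x hx => ?_
    rw [twoSidedBetaDeriv_succ r ha hb (by linarith) m hx, hD x hx, ih x hx,
      derivative_momentPoly_succ]
    simp only [eval_add, eval_mul, eval_X, eval_C]
    ring

lemma intervalIntegrable_left {a b x : ℝ} (hb : 0 < b) (hab : a + b < 2)
    (hx : x ∈ Set.Ioo (0 : ℝ) 1) (φ : ℝ[X]) :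
    IntervalIntegrable
      (fun s => (1 - s) ^ (a - 1) * s ^ (b - 1) * φ.eval s * (x - s) ^ (-(a + b - 1)))
      volume 0 x := by
  refine ((intervalIntegrable_betaRL (g := a + b - 1) (p := b - 1) (by linarith) (by linarith)
    hx.1 hx.2 (a - 1)).mul_continuousOn φ.continuous.continuousOn).congr_uIoo fun s _ => ?_
  ring

lemma intervalIntegrable_right {a b x : ℝ} (ha : 0 < a) (hab : a + b < 2)
    (hx : x ∈ Set.Ioo (0 : ℝ) 1) (φ : ℝ[X]) :
    IntervalIntegrable
      (fun s => (1 - s) ^ (a - 1) * s ^ (b - 1) * φ.eval s * (s - x) ^ (-(a + b - 1)))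
      volume x 1 := by
  refine ((intervalIntegrable_betaRL_right (g := a + b - 1) (q := a - 1) (by linarith)
    (by linarith) hx.1 hx.2 (b - 1)).mul_continuousOn φ.continuous.continuousOn).congr_uIoo
    fun s _ => ?_
  ring

lemma integral_left_monomial {x : ℝ} (hx : 0 < x) (a b c : ℝ) (m : ℕ) :
    ∫ s in (0 : ℝ)..x, (1 - s) ^ (a - 1) * s ^ (b - 1) * (monomial m c).eval s *
        (x - s) ^ (-(a + b - 1)) = c * betaRL (a + b - 1) (b - 1 + m) (a - 1) x := by
  rw [← integral_betaRL hx, ← intervalIntegral.integral_const_mul]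
  refine intervalIntegral.integral_congr_uIoo fun s hs => ?_
  rw [Set.uIoo_of_le hx.le] at hs
  rw [eval_monomial, Real.rpow_add_natCast hs.1.ne']
  ring

lemma integral_right_monomial {x : ℝ} (hx : x ∈ Set.Ioo (0 : ℝ) 1) (a b c : ℝ) (m : ℕ) :
    ∫ s in x..(1 : ℝ), (1 - s) ^ (a - 1) * s ^ (b - 1) * (monomial m c).eval s *
        (s - x) ^ (-(a + b - 1)) = c * betaRL (a + b - 1) (a - 1) (b - 1 + m) (1 - x) := by
  rw [← integral_betaRL_right hx.2, ← intervalIntegral.integral_const_mul]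
  refine intervalIntegral.integral_congr_uIoo fun s hs => ?_
  rw [Set.uIoo_of_le hx.2.le] at hs
  rw [eval_monomial, Real.rpow_add_natCast (hx.1.trans hs.1).ne']
  ring

lemma integral_add_integral_eq_momentMap {r a b x : ℝ} (ha : 0 < a) (ha1 : a < 1) (hb : 0 < b)
    (hb1 : b ≤ 1) (hr : r * Real.sin (π * a) = (1 - r) * Real.sin (π * b))
    (hx : x ∈ Set.Ioo (0 : ℝ) 1) (φ : ℝ[X]) :
    r * (∫ s in (0 : ℝ)..x,
        (1 - s) ^ (a - 1) * s ^ (b - 1) * φ.eval s * (x - s) ^ (-(a + b - 1))) +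
      (1 - r) * (∫ s in x..(1 : ℝ),
        (1 - s) ^ (a - 1) * s ^ (b - 1) * φ.eval s * (s - x) ^ (-(a + b - 1))) =
      (1 - r) * (Real.Gamma a * Real.Gamma (1 - a)) * (momentMap a b φ).eval x := by
  induction φ using Polynomial.induction_on' with
  | add p q hp hq =>
    have hab : a + b < 2 := by linarith
    have h1 := intervalIntegral.integral_add (intervalIntegrable_left hb hab hx p)
      (intervalIntegrable_left hb hab hx q)
    have h2 := intervalIntegral.integral_add (intervalIntegrable_right ha hab hx p)
      (intervalIntegrable_right ha hab hx q)
    simp only [eval_add, map_add, mul_add, add_mul] at h1 h2 ⊢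
    rw [h1, h2]
    linear_combination hp + hq
  | monomial m c =>
    have h := twoSidedBeta_eq ha ha1 hb hb1 hr m x hx
    rw [twoSidedBeta] at h
    rw [integral_left_monomial hx.1, integral_right_monomial hx, momentMap_monomial, eval_mul,
      eval_C]
    linear_combination c * h

lemma fracComb_eq_momentMap {r α a b x : ℝ} (hα : α = a + b) (ha : 0 < a) (ha1 : a < 1)
    (hb : 0 < b) (hb1 : b ≤ 1) (hr : r * Real.sin (π * a) = (1 - r) * Real.sin (π * b))
    {w : ℝ → ℝ} {φ : ℝ[X]}
    (hw : ∀ s ∈ Set.Ioo (0 : ℝ) 1, w s = (1 - s) ^ (a - 1) * s ^ (b - 1) * φ.eval s)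
    (hx : x ∈ Set.Ioo (0 : ℝ) 1) :
    fracComb r α w x = (1 - r) * (Real.Gamma a * Real.Gamma (1 - a)) / Real.Gamma (2 - α) *
      (momentMap a b φ).eval x := by
  have h := integral_add_integral_eq_momentMap ha ha1 hb hb1 hr hx φ
  have e : 2 - α - 1 = -(a + b - 1) := by rw [hα]; ring
  have h1 : ∫ s in (0 : ℝ)..x, w s * (x - s) ^ (2 - α - 1) = ∫ s in (0 : ℝ)..x,
      (1 - s) ^ (a - 1) * s ^ (b - 1) * φ.eval s * (x - s) ^ (-(a + b - 1)) := by
    refine intervalIntegral.integral_congr_uIoo fun s hs => ?_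
    rw [Set.uIoo_of_le hx.1.le] at hs
    rw [hw s ⟨hs.1, hs.2.trans hx.2⟩, e]
  have h2 : ∫ s in x..(1 : ℝ), w s * (s - x) ^ (2 - α - 1) = ∫ s in x..(1 : ℝ),
      (1 - s) ^ (a - 1) * s ^ (b - 1) * φ.eval s * (s - x) ^ (-(a + b - 1)) := by
    refine intervalIntegral.integral_congr_uIoo fun s hs => ?_
    rw [Set.uIoo_of_le hx.2.le] at hs
    rw [hw s ⟨hx.1.trans hs.1, hs.2⟩, e]
  rw [fracComb, leftFracInt, rightFracInt, h1, h2]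
  linear_combination 1 / Real.Gamma (2 - α) * h

lemma hasDerivAt_fracComb_s10 {r α a b x : ℝ} (hα : α = a + b) (ha : 0 < a) (ha1 : a < 1)
    (hb : 0 < b) (hb1 : b ≤ 1) (hr : r * Real.sin (π * a) = (1 - r) * Real.sin (π * b))
    {w : ℝ → ℝ} {φ : ℝ[X]}
    (hw : ∀ s ∈ Set.Ioo (0 : ℝ) 1, w s = (1 - s) ^ (a - 1) * s ^ (b - 1) * φ.eval s)
    (hx : x ∈ Set.Ioo (0 : ℝ) 1) :
    HasDerivAt (fracComb r α w)
      ((1 - r) * (Real.Gamma a * Real.Gamma (1 - a)) / Real.Gamma (2 - α) *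
        (derivative (momentMap a b φ)).eval x) x := by
  refine (((momentMap a b φ).hasDerivAt x).const_mul _).congr_of_eventuallyEq ?_
  filter_upwards [Ioo_mem_nhds hx.1 hx.2] with y hy
  exact fracComb_eq_momentMap hα ha ha1 hb hb1 hr hw hy

lemma jacobiG_eq_eval (a b : ℝ) (n : ℕ) (t : ℝ) : jacobiG a b n t = (jacobiPoly a b n).eval t := by
  rw [jacobiG, jacobiP, jacobiPoly, eval_finsetSum]
  refine Finset.sum_congr rfl fun m hm => ?_
  have hm' : m ≤ n := Nat.lt_succ_iff.mp (Finset.mem_range.mp hm)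
  have e1 : 2 * t - 1 - 1 = 2 * (t - 1) := by ring
  have e2 : 2 * t - 1 + 1 = 2 * t := by ring
  have e3 : (2 : ℝ) ^ n = 2 ^ (n - m) * 2 ^ m := by rw [← pow_add, Nat.sub_add_cancel hm']
  simp only [eval_mul, eval_C, eval_pow, eval_X, eval_sub, eval_one]
  rw [e1, e2, e3, mul_pow, mul_pow, jacobiCoeff]
  field_simp

lemma jacobiG_zero {a b : ℝ} (ha : -1 < a) (hb : -1 < b) (t : ℝ) : jacobiG a b 0 t = 1 := by
  have h1 := (Real.Gamma_pos_of_pos (show 0 < a + 1 by linarith)).ne'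
  have h2 := (Real.Gamma_pos_of_pos (show 0 < b + 1 by linarith)).ne'
  simp [jacobiG, jacobiP, h1, h2]

/-- `𝒩_r^α q_N(x) = Σ_{i=0}^N [f_i/|‖G_i^{(β-1,α-β-1)}‖|²] G_i^{(β-1,α-β-1)}(x)` on `(0,1)`. -/
theorem N_of_qN (α β : ℝ) (hα1 : 1 < α) (hα2 : α < 2)
    (hβ1 : α - 1 < β) (hβ2 : β ≤ 1)
    (r : ℝ) (hr : r = Real.sin (π * β) / (Real.sin (π * (α - β)) + Real.sin (π * β)))
    (lamm1 : ℝ)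
    (hlamm1 : lamm1 = -(1 - r) * Real.Gamma α * Real.sin (π * α) / Real.sin (π * (α - β)))
    (f : ℝ → ℝ)
    (hf : IntegrableOn (fun x => rho (β - 1) (α - β - 1) x * f x ^ 2) (Set.Ioo 0 1))
    (fc : ℕ → ℝ)
    (hfc : ∀ i, fc i = ∫ x in (0:ℝ)..1,
        rho (β - 1) (α - β - 1) x * f x * jacobiG (β - 1) (α - β - 1) i x)
    (c : ℕ → ℝ)
    (hc : ∀ i, c i = fc (i + 1) / (lamda α β i * Gnorm2 (β - 1) (α - β - 1) (i + 1)))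
    (cm1 : ℝ) (hcm1 : cm1 = fc 0 / (lamm1 * Gnorm2 (β - 1) (α - β - 1) 0))
    (k : ℝ → ℝ) (hk : ∀ x, k x = (1 - x) ^ (α - β - 1) * x ^ (β - 1))
    (qN : ℕ → ℝ → ℝ)
    (hqN : ∀ N x, qN N x = cm1 * x * k x +
        rho (α - β) β x * ∑ i ∈ Finset.range N, c i * jacobiG (α - β) β i x)
    (N : ℕ) (x : ℝ) (hx : x ∈ Set.Ioo (0:ℝ) 1) :
    HasDerivAt (fracComb r α (qN N))
      (∑ i ∈ Finset.range (N + 1),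
        fc i / Gnorm2 (β - 1) (α - β - 1) i * jacobiG (β - 1) (α - β - 1) i x) x := by
  set a := α - β with ha_def
  have ha : 0 < a := by linarith
  have ha1 : a < 1 := by linarith
  have hb : 0 < β := by linarith
  have hsa : 0 < Real.sin (π * a) :=
    Real.sin_pos_of_pos_of_lt_pi (by positivity) (by nlinarith [Real.pi_pos])
  have hsb : 0 ≤ Real.sin (π * β) :=
    Real.sin_nonneg_of_nonneg_of_le_pi (by positivity) (by nlinarith [Real.pi_pos])
  have hS : Real.sin (π * a) + Real.sin (π * β) ≠ 0 := by positivity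
  have h1r : 1 - r = Real.sin (π * a) / (Real.sin (π * a) + Real.sin (π * β)) := by
    rw [hr]
    field_simp
    ring
  have hr' : r * Real.sin (π * a) = (1 - r) * Real.sin (π * β) := by
    rw [h1r, hr]
    ring
  have hGα : Real.Gamma α = (α - 1) * Real.Gamma (α - 1) := by
    rw [← Real.Gamma_add_one (by linarith), sub_add_cancel]
  have hsα : Real.sin (π * (α - 1)) = -Real.sin (π * α) := by
    rw [mul_sub, mul_one, Real.sin_sub_pi]
  have hsα1 : 0 < Real.sin (π * (α - 1)) :=
    Real.sin_pos_of_pos_of_lt_pi (mul_pos Real.pi_pos (by linarith)) (by nlinarith [Real.pi_pos])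
  have hsα0 : Real.sin (π * α) ≠ 0 := by linarith
  have hΓ1 : 0 < Real.Gamma (α - 1) := Real.Gamma_pos_of_pos (by linarith)
  have hΓ2 : 0 < Real.Gamma (2 - α) := Real.Gamma_pos_of_pos (by linarith)
  have hK : (1 - r) * (Real.Gamma a * Real.Gamma (1 - a)) / Real.Gamma (2 - α) =
      -(Real.sin (π * α) / (Real.sin (π * a) + Real.sin (π * β))) * Real.Gamma (α - 1) := by
    have g := Real.Gamma_mul_Gamma_one_sub (α - 1)
    have e : 1 - (α - 1) = 2 - α := by ring
    rw [e, hsα, eq_div_iff (by linarith)] at g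
    rw [h1r, Real.Gamma_mul_Gamma_one_sub, div_eq_iff hΓ2.ne']
    field_simp
    linear_combination -g
  have hlam1 : (1 - r) * (Real.Gamma a * Real.Gamma (1 - a)) / Real.Gamma (2 - α) * (α - 1) =
      lamm1 := by
    rw [hK, hlamm1, h1r, hGα]
    field_simp
  have hlam : ∀ i : ℕ, (1 - r) * (Real.Gamma a * Real.Gamma (1 - a)) / Real.Gamma (2 - α) *
      -(((i : ℝ) + 1) * binomSeriesCoeff (α - 1) (i + 1)) = lamda α β i := by
    intro i
    have hi : (i : ℝ) + 1 ≠ 0 := by positivity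
    have hf : (i.factorial : ℝ) ≠ 0 := by positivity
    have e : α - 1 + ((i + 1 : ℕ) : ℝ) = i + α := by push_cast; ring
    rw [hK, binomSeriesCoeff_eq_Gamma (by linarith), lamda, e, Nat.factorial_succ, ← ha_def]
    push_cast
    field_simp
  have hlam1_ne : lamm1 ≠ 0 := by
    rw [← hlam1, hK]
    refine mul_ne_zero (mul_ne_zero (neg_ne_zero.mpr (div_ne_zero hsα0 hS)) hΓ1.ne') ?_
    linarith
  have hlam_ne : ∀ i, lamda α β i ≠ 0 := by
    intro i
    have hi : 0 < (i : ℝ) + α := by positivity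
    exact mul_ne_zero (div_ne_zero hsα0 hS)
      (div_ne_zero (Real.Gamma_pos_of_pos hi).ne' (by positivity))
  set φ : ℝ[X] := C cm1 * X +
    ∑ i ∈ Finset.range N, C (c i) * (X * (1 - X) * jacobiPoly a β i) with hφ
  have hw : ∀ s ∈ Set.Ioo (0 : ℝ) 1,
      qN N s = (1 - s) ^ (a - 1) * s ^ (β - 1) * φ.eval s := by
    intro s hs
    have h1s : 0 < 1 - s := by linarith [hs.2]
    have e1 : (1 - s) ^ a = (1 - s) ^ (a - 1) * (1 - s) := by
      rw [← Real.rpow_add_one h1s.ne', sub_add_cancel]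
    have e2 : s ^ β = s ^ (β - 1) * s := by
      rw [← Real.rpow_add_one hs.1.ne', sub_add_cancel]
    rw [hqN, hk, rho, e1, e2, hφ]
    simp only [eval_add, eval_mul, eval_C, eval_X, eval_finsetSum, eval_sub, eval_one,
      jacobiG_eq_eval, mul_add, Finset.mul_sum]
    congr 1
    · ring
    · exact Finset.sum_congr rfl fun i _ => by ring
  refine (hasDerivAt_fracComb_s10 (by linarith) ha ha1 hb hβ2 hr' hw hx).congr_deriv ?_
  have eα : a + β - 1 = α - 1 := by linarith
  have hcm1' : cm1 * lamm1 = fc 0 / Gnorm2 (β - 1) (a - 1) 0 := by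
    rw [hcm1]
    field_simp
  have hc' : ∀ i, c i * lamda α β i = fc (i + 1) / Gnorm2 (β - 1) (a - 1) (i + 1) := by
    intro i
    have := hlam_ne i
    rw [hc]
    field_simp
  rw [hφ, map_add, map_sum, derivative_add, derivative_sum, momentMap_C_mul, derivative_C_mul,
    derivative_momentMap_X, eval_add, eval_finsetSum, Finset.sum_range_succ', mul_add,
    Finset.mul_sum, add_comm]
  congr 1
  · refine Finset.sum_congr rfl fun i _ => ?_
    rw [momentMap_C_mul, derivative_C_mul, derivative_momentMap_jacobiPoly ha hb (by linarith),
      ← hc' i, ← hlam i, jacobiG_eq_eval, eα]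
    simp only [eval_mul, eval_C]
    ring
  · rw [← hcm1', ← hlam1, jacobiG_zero (by linarith) (by linarith), eα]
    simp only [eval_mul, eval_C]
    ring
end
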